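/- arXiv:2302.13308 — 2 statements merged into one kernel-verified Lean document; each statement's English description precedes it below -/
import Mathlib

section
/- Let d ≥ 2 and δ_d := d·4^d. Let M = n(u)a(v)k with u ∈ [−1/2,1/2]^{d(d−1)/2}, v ∈ ℝ^d_{>0} satisfying v_1⋯v_d = 1 and 0 < v_{j+1} ≤ (2/√3)v_j for 1 ≤ j < d, and k ∈ SO(d). Let 1 ≤ s ≤ d−1 and l_1,…,l_s ∈ ℤ_{≥0}, and suppose v_i > δ_d 2^{l_i} for i = 1,…,s. Then for each i = 1,…,s the i-th row β_i := e_i (M^T)^{−1} of the inverse transpose of M satisfies ‖β_i‖ ≤ δ_d v_i^{−1} < 2^{−l_i}. -/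
open MeasureTheory Filter Matrix
open scoped Topology Classical

noncomputable section

/-- Distance from `x : ℝ` to the nearest integer. -/
def distToInt (x : ℝ) : ℝ := |x - round x|

/-- ζ(ξ,T) from the paper. -/
def zetaDio {d : ℕ} (ξ : Fin d → ℝ) (T : ℝ) : ℕ :=
  sInf {N : ℕ | ∃ m : Fin d → ℤ, m ≠ 0 ∧ (∀ i, |m i| ≤ (N : ℤ)) ∧
    distToInt (∑ i, ξ i * (m i : ℝ)) ≤ 1 / T}

/-- Euclidean norm on row vectors. -/
def enorm' {d : ℕ} (x : Fin d → ℝ) : ℝ := Real.sqrt (∑ i, (x i) ^ 2)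

/-- π₁ : ℝ^d → ℝ, the first coordinate. -/
def head' {d : ℕ} (x : Fin d → ℝ) : ℝ := if h : 0 < d then x ⟨0, h⟩ else 0

/-- The upper triangular unipotent matrix n(u). -/
def nMat (d : ℕ) (u : Fin d → Fin d → ℝ) : Matrix (Fin d) (Fin d) ℝ :=
  Matrix.of fun i j => if i = j then 1 else if i < j then u i j else 0

/-- The constant c_d = d (2/√3)^d. -/
def cd' (d : ℕ) : ℝ := d * (2 / Real.sqrt 3) ^ d

/-- The constant δ_d = d·4^d. -/
def deltad (d : ℕ) : ℝ := d * 4 ^ d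

/-- Siegel conditions on the diagonal part v. -/
def SiegelV (d : ℕ) (v : Fin d → ℝ) : Prop :=
  (∀ i, 0 < v i) ∧ (∏ i, v i = 1) ∧
  ∀ i j : Fin d, (i : ℕ) + 1 = (j : ℕ) → v j ≤ 2 / Real.sqrt 3 * v i

/-- s_r(g): the largest index 1 ≤ i ≤ d−1 (1-based) with v_i > 2 c_d r, or 0. -/
def sVal (d : ℕ) (r : ℝ) (v : Fin d → ℝ) : ℕ :=
  sSup {s : ℕ | 1 ≤ s ∧ s ≤ d - 1 ∧ ∃ i : Fin d, (i : ℕ) + 1 = s ∧ 2 * cd' d * r < v i}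

/-- The function F_{R,η,r} expressed in the Siegel coordinates (v, b). -/
def Ffun (d : ℕ) (R η r : ℝ) (v b : Fin d → ℝ) : ℝ :=
  (if R ≤ ∏ i ∈ Finset.univ.filter (fun i : Fin d => (i : ℕ) < sVal d r v), v i
    then 1 else 0) *
  ∏ i ∈ Finset.univ.filter (fun i : Fin d => (i : ℕ) < sVal d r v),
    (v i ^ η * if |v i * b i| ≤ cd' d * r then 1 else 0)

/-- g' = (γ,m)·g for some (γ,m) ∈ Γ' = SL(d,ℤ) ⋉ ℤ^d, where group elements of
G' = SL(d,ℝ) ⋉ ℝ^d are represented as pairs (M,b) with (M,b)(M',b') = (MM', bM'+b'). -/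
def gammaRel (d : ℕ) (g g' : Matrix (Fin d) (Fin d) ℝ × (Fin d → ℝ)) : Prop :=
  ∃ (γ : Matrix (Fin d) (Fin d) ℤ) (m : Fin d → ℤ), γ.det = 1 ∧
    g'.1 = (γ.map fun x => (x : ℝ)) * g.1 ∧
    g'.2 = Matrix.vecMul (fun i => (m i : ℝ)) g.1 + g.2

/-- A measurable section of Γ'\G' into the Siegel set 𝒮', recorded through its
Iwasawa coordinates: `vc g` and `bc g` are the v- and b-coordinates of the Siegel
representative of Γ'g, for every g ∈ G'. -/
def IsSiegelSection (d : ℕ)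
    (vc bc : (Matrix (Fin d) (Fin d) ℝ × (Fin d → ℝ)) → (Fin d → ℝ)) : Prop :=
  Measurable (fun g : (Fin d → Fin d → ℝ) × (Fin d → ℝ) => vc (Matrix.of g.1, g.2)) ∧
  Measurable (fun g : (Fin d → Fin d → ℝ) × (Fin d → ℝ) => bc (Matrix.of g.1, g.2)) ∧
  ∀ g : Matrix (Fin d) (Fin d) ℝ × (Fin d → ℝ), g.1.det = 1 →
    SiegelV d (vc g) ∧ (∀ i, |bc g i| ≤ 1 / 2) ∧
    ∃ (u : Fin d → Fin d → ℝ) (k : Matrix (Fin d) (Fin d) ℝ),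
      (∀ i j : Fin d, i < j → |u i j| ≤ 1 / 2) ∧ k * kᵀ = 1 ∧ k.det = 1 ∧
      gammaRel d g
        (nMat d u * Matrix.diagonal (vc g) * k,
         Matrix.vecMul (bc g) (nMat d u * Matrix.diagonal (vc g) * k))

/-- The matrix ñ(y), with ones on the diagonal and first row (1, y). -/
def ntilde (d : ℕ) (y : Fin (d - 1) → ℝ) : Matrix (Fin d) (Fin d) ℝ :=
  Matrix.of fun i j =>
    if i = j then 1
    else if h : (i : ℕ) = 0 ∧ 1 ≤ (j : ℕ) then
      y ⟨(j : ℕ) - 1, by have := j.isLt; omega⟩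
    else 0

/-- The diagonal flow Φ_t. -/
def Phi (d : ℕ) (t : ℝ) : Matrix (Fin d) (Fin d) ℝ :=
  Matrix.diagonal fun i : Fin d =>
    if (i : ℕ) = 0 then Real.exp (-((d : ℝ) - 1) * t / d) else Real.exp (t / d)

/-- The element Γ'(1,ξ)(M₀ ñ(y) Φ_t, 0) represented in G' as a pair. -/
def gElt (d : ℕ) (ξ : Fin d → ℝ) (M0 : Matrix (Fin d) (Fin d) ℝ)
    (y : Fin (d - 1) → ℝ) (t : ℝ) : Matrix (Fin d) (Fin d) ℝ × (Fin d → ℝ) :=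
  (M0 * ntilde d y * Phi d t, Matrix.vecMul ξ (M0 * ntilde d y * Phi d t))

/-- π' : ℝ^d → ℝ^{d-1}, dropping the first coordinate. -/
def tail' {d : ℕ} (x : Fin d → ℝ) : Fin (d - 1) → ℝ :=
  fun i => x ⟨(i : ℕ) + 1, by have := i.isLt; omega⟩

/-- The lattice Λ = ℤ^d (M₀^{-1})ᵀ. -/
def Lam (d : ℕ) (M0 : Matrix (Fin d) (Fin d) ℝ) : Set (Fin d → ℝ) :=
  {x | ∃ m : Fin d → ℤ, x = Matrix.vecMul (fun i => (m i : ℝ)) (M0⁻¹)ᵀ}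

/-- Λ_k = ℛ_k ∩ Λ. Here `‖tail' x‖` is the sup norm |π'x|. -/
def LamK (d : ℕ) (M0 : Matrix (Fin d) (Fin d) ℝ) (k : ℤ) : Set (Fin d → ℝ) :=
  {x ∈ Lam d M0 | |head' x| < (2:ℝ) ^ (k + 2) ∧ (2:ℝ) ^ k ≤ ‖tail' x‖ ∧ ‖tail' x‖ < (2:ℝ) ^ (k + 1)}

/-- Norm of the wedge product via the Gram determinant. -/
def wedgeNorm {d n : ℕ} (x : Fin n → Fin d → ℝ) : ℝ :=
  Real.sqrt (Matrix.det (Matrix.of fun i j : Fin n => ∑ t, x i t * x j t))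

/-- Norm of the wedge of the first j vectors (empty wedge has norm 1). -/
def prefixWedge {d s : ℕ} (x : Fin s → Fin d → ℝ) (j : ℕ) : ℝ :=
  wedgeNorm fun i : Fin (min j s) => x ⟨(i : ℕ), by have := i.isLt; omega⟩

/-- The set Λ_k(p). -/
def LamKP (d s : ℕ) (M0 : Matrix (Fin d) (Fin d) ℝ) (k : Fin s → ℤ) (p : Fin s → ℕ) :
    Set (Fin s → Fin d → ℝ) :=
  {x | (∀ j, x j ∈ LamK d M0 (k j)) ∧
    ∀ j : Fin s,
      (2:ℝ) ^ (-(p j : ℤ) - 1) * enorm' (x j) * prefixWedge x (j : ℕ) < prefixWedge x ((j : ℕ) + 1) ∧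
      prefixWedge x ((j : ℕ) + 1) ≤ (2:ℝ) ^ (-(p j : ℤ)) * enorm' (x j) * prefixWedge x (j : ℕ)}

/-- Operator norm ‖M₀‖ of a matrix acting on Euclidean space. -/
def opNorm {d : ℕ} (M : Matrix (Fin d) (Fin d) ℝ) : ℝ :=
  ‖LinearMap.toContinuousLinearMap (Matrix.toEuclideanLin M)‖

/-- K₀ is the largest integer such that
{x ∈ Λ : |π₁x| < 2^{k+1}, |π'x| < 2^k} = ∅ for all k ≤ K₀. -/
def IsK0 (d : ℕ) (M0 : Matrix (Fin d) (Fin d) ℝ) (K0 : ℤ) : Prop :=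
  (∀ k : ℤ, k ≤ K0 → ¬ ∃ x ∈ Lam d M0, |head' x| < (2:ℝ) ^ (k + 1) ∧ ‖tail' x‖ < (2:ℝ) ^ k) ∧
  (∀ K' : ℤ, (∀ k : ℤ, k ≤ K' → ¬ ∃ x ∈ Lam d M0, |head' x| < (2:ℝ) ^ (k + 1) ∧ ‖tail' x‖ < (2:ℝ) ^ k) → K' ≤ K0)



lemma aux_row {d : ℕ} (u : Fin d → Fin d → ℝ) (x : Fin d → ℝ) (j : Fin d) :
    (nMat d u *ᵥ x) j = x j + ∑ m ∈ Finset.univ.filter (fun m : Fin d => j < m), u j m * x m := by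
  have h : ∀ m, nMat d u j m * x m =
      (if j = m then x m else 0) + (if j < m then u j m * x m else 0) := by
    intro m
    simp only [nMat, Matrix.of_apply]
    by_cases h1 : j = m
    · subst h1; simp
    · simp [h1]
  simp only [Matrix.mulVec, dotProduct, h, Finset.sum_add_distrib, Finset.sum_ite_eq,
    Finset.mem_univ, if_true, Finset.sum_filter]

lemma aux_zero {d : ℕ} (u : Fin d → Fin d → ℝ) (x : Fin d → ℝ) (i : Fin d)
    (hx : nMat d u *ᵥ x = Pi.single i 1) : ∀ n : ℕ, ∀ j : Fin d, d - (j : ℕ) = n → i < j → x j = 0 := by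
  intro n
  induction n using Nat.strong_induction_on with
  | _ n ih =>
    intro j hj hij
    have h := congrFun hx j
    rw [aux_row, Pi.single_eq_of_ne hij.ne', Finset.sum_eq_zero, add_zero] at h
    · exact h
    · intro m hm
      have hm' : j < m := by simpa using hm
      rw [ih (d - (m : ℕ)) (by have := m.isLt; have : (j : ℕ) < m := hm'; omega) m rfl (hij.trans hm'), mul_zero]

lemma aux_sum {d : ℕ} (u : Fin d → Fin d → ℝ)
    (hu : ∀ i j : Fin d, i < j → |u i j| ≤ 1 / 2) (x : Fin d → ℝ) (i : Fin d)
    (hx : nMat d u *ᵥ x = Pi.single i 1) : ∀ n : ℕ, n ≤ d →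
      ∑ j ∈ Finset.univ.filter (fun j : Fin d => d - n ≤ (j : ℕ)), |x j| + 1 ≤ 2 ^ n := by
  intro n
  induction n with
  | zero =>
    intro _
    rw [Finset.sum_eq_zero]
    · simp
    · intro j hj
      have := j.isLt
      have h2 : d - 0 ≤ (j : ℕ) := by simpa using hj
      omega
  | succ n ih =>
    intro hn
    have ih := ih (by omega)
    let j : Fin d := ⟨d - (n + 1), by omega⟩
    have hf : Finset.univ.filter (fun m : Fin d => d - (n + 1) ≤ (m : ℕ)) =
        insert j (Finset.univ.filter (fun m : Fin d => d - n ≤ (m : ℕ))) := by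
      ext m
      simp only [Finset.mem_filter, Finset.mem_univ, true_and, Finset.mem_insert, Fin.ext_iff, j]
      omega
    have hf2 : Finset.univ.filter (fun m : Fin d => j < m) =
        Finset.univ.filter (fun m : Fin d => d - n ≤ (m : ℕ)) := by
      ext m
      simp only [Finset.mem_filter, Finset.mem_univ, true_and, Fin.lt_def, j]
      omega
    have hnot : j ∉ Finset.univ.filter (fun m : Fin d => d - n ≤ (m : ℕ)) := by
      simp only [Finset.mem_filter, Finset.mem_univ, true_and, j]
      omega
    rw [hf, Finset.sum_insert hnot]
    have h := congrFun hx j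
    rw [aux_row] at h
    have hs : |∑ m ∈ Finset.univ.filter (fun m : Fin d => j < m), u j m * x m| ≤
        1 / 2 * ∑ m ∈ Finset.univ.filter (fun m : Fin d => d - n ≤ (m : ℕ)), |x m| := by
      rw [← hf2, Finset.mul_sum]
      refine (Finset.abs_sum_le_sum_abs _ _).trans (Finset.sum_le_sum ?_)
      intro m hm
      rw [abs_mul]
      exact mul_le_mul_of_nonneg_right (hu j m (by simpa using hm)) (abs_nonneg _)
    have h1 : |(Pi.single i 1 : Fin d → ℝ) j| ≤ 1 := by
      by_cases hij : j = i
      · rw [hij]; simp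
      · rw [Pi.single_eq_of_ne hij]; simp
    rw [← h] at h1
    have hT : 0 ≤ ∑ m ∈ Finset.univ.filter (fun m : Fin d => d - n ≤ (m : ℕ)), |x m| :=
      Finset.sum_nonneg (fun _ _ => abs_nonneg _)
    have h3 : |x j| ≤ 1 + 1 / 2 * ∑ m ∈ Finset.univ.filter (fun m : Fin d => d - n ≤ (m : ℕ)), |x m| := by
      have := abs_sub_abs_le_abs_add (x j) (∑ m ∈ Finset.univ.filter (fun m : Fin d => j < m), u j m * x m)
      linarith
    rw [pow_succ]
    linarith

lemma aux_chain {d : ℕ} (v : Fin d → ℝ) (hv : ∀ i, 0 < v i)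
    (hvchain : ∀ i j : Fin d, (i : ℕ) + 1 = (j : ℕ) → v j ≤ 2 / Real.sqrt 3 * v i) :
    ∀ n : ℕ, ∀ i j : Fin d, (j : ℕ) + n = i → v i ≤ 2 ^ n * v j := by
  have hc : 2 / Real.sqrt 3 ≤ 2 := by
    apply div_le_self (by norm_num)
    rw [Real.one_le_sqrt]; norm_num
  intro n
  induction n with
  | zero => intro i j h; have : j = i := Fin.ext (by omega)
            subst this; simp
  | succ n ih =>
    intro i j h
    have hi := i.isLt
    have h1 := ih ⟨(j : ℕ) + n, by omega⟩ j rfl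
    have h2 := hvchain ⟨(j : ℕ) + n, by omega⟩ i (by simp; omega)
    have h3 := mul_le_mul_of_nonneg_right hc (hv ⟨(j : ℕ) + n, by omega⟩).le
    rw [pow_succ]
    linarith

lemma aux_det (d : ℕ) (u : Fin d → Fin d → ℝ) : (nMat d u).det = 1 := by
  rw [Matrix.det_of_upperTriangular]
  · simp [nMat]
  · intro i j hij
    have hij' : j < i := hij
    simp [nMat, hij'.ne', hij'.not_gt]

lemma aux_l1 {d : ℕ} (y : Fin d → ℝ) : enorm' y ≤ ∑ j, |y j| := by
  unfold enorm'
  apply Real.sqrt_le_iff.2 ⟨Finset.sum_nonneg (fun _ _ => abs_nonneg _), ?_⟩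
  have := Finset.sum_sq_le_sq_sum_of_nonneg (s := Finset.univ) (f := fun j => |y j|)
    (fun _ _ => abs_nonneg _)
  simpa using this

lemma aux_main {d : ℕ} (u : Fin d → Fin d → ℝ)
    (hu : ∀ i j : Fin d, i < j → |u i j| ≤ 1 / 2)
    (v : Fin d → ℝ) (hv : ∀ i, 0 < v i) (hv1 : ∏ i, v i = 1)
    (hvchain : ∀ i j : Fin d, (i : ℕ) + 1 = (j : ℕ) → v j ≤ 2 / Real.sqrt 3 * v i)
    (k : Matrix (Fin d) (Fin d) ℝ) (hk : k * kᵀ = 1) (hkdet : k.det = 1) (i : Fin d) :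
    enorm' (Matrix.vecMul (Pi.single i 1)
          (((nMat d u * Matrix.diagonal v * k)ᵀ)⁻¹)) ≤ deltad d * (v i)⁻¹ := by
  set M := nMat d u * Matrix.diagonal v * k with hM
  have hdet : IsUnit (Mᵀ).det := by
    rw [Matrix.det_transpose, hM, Matrix.det_mul, Matrix.det_mul, aux_det, Matrix.det_diagonal, hv1, hkdet]
    simp
  set b := Matrix.vecMul (Pi.single i 1) (Mᵀ)⁻¹ with hb
  have hbM : M *ᵥ b = Pi.single i 1 := by
    rw [← Matrix.vecMul_transpose, hb, Matrix.vecMul_vecMul, Matrix.nonsing_inv_mul _ hdet,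
      Matrix.vecMul_one]
  set y := k *ᵥ b with hy
  have hnorm : enorm' b = enorm' y := by
    have h1 : ∀ z : Fin d → ℝ, ∑ j, z j ^ 2 = z ⬝ᵥ z := by
      intro z; simp [dotProduct, sq]
    unfold enorm'
    rw [h1, h1, hy, Matrix.dotProduct_mulVec, Matrix.vecMul_mulVec, mul_eq_one_comm.1 hk,
      Matrix.vecMul_one]
  set x := Matrix.diagonal v *ᵥ y with hx
  have hxe : nMat d u *ᵥ x = Pi.single i 1 := by
    rw [← hbM, hx, hy, hM, Matrix.mulVec_mulVec, Matrix.mulVec_mulVec, Matrix.mul_assoc]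
  have hxj : ∀ j, x j = v j * y j := fun j => by rw [hx, Matrix.mulVec_diagonal]
  have hsum := aux_sum u hu x i hxe d le_rfl
  simp only [Nat.sub_self, Nat.zero_le, Finset.filter_true] at hsum
  rw [hnorm]
  have hyj : ∀ j, |y j| ≤ 2 ^ d * (v i)⁻¹ * |x j| := by
    intro j
    by_cases hij : i < j
    · have h0 := aux_zero u x i hxe _ j rfl hij
      have : y j = 0 := by
        have := hxj j
        rw [h0] at this
        rcases mul_eq_zero.1 this.symm with h | h
        · exact absurd h (hv j).ne'
        · exact h
      simp [this, h0]
    · have hle : (j : ℕ) ≤ i := not_lt.1 hij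
      have hi := i.isLt
      have h1 := aux_chain v hv hvchain (i - j) i j (by omega)
      have h2 : (2 : ℝ) ^ ((i : ℕ) - j) ≤ 2 ^ d := pow_le_pow_right₀ (by norm_num) (by omega)
      have h3 : v i ≤ 2 ^ d * v j := h1.trans (mul_le_mul_of_nonneg_right h2 (hv j).le)
      rw [hxj, abs_mul, abs_of_pos (hv j)]
      have h4 : 1 ≤ 2 ^ d * (v i)⁻¹ * v j := by
        have := hv i
        rw [← div_eq_mul_inv, div_mul_eq_mul_div, le_div_iff₀ this]
        linarith
      nlinarith [abs_nonneg (y j)]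
  calc enorm' y ≤ ∑ j, |y j| := aux_l1 y
    _ ≤ ∑ j, 2 ^ d * (v i)⁻¹ * |x j| := Finset.sum_le_sum (fun j _ => hyj j)
    _ = 2 ^ d * (v i)⁻¹ * ∑ j, |x j| := by rw [Finset.mul_sum]
    _ ≤ 2 ^ d * (v i)⁻¹ * 2 ^ d := by
        apply mul_le_mul_of_nonneg_left _ (by have := hv i; positivity)
        linarith
    _ = 4 ^ d * (v i)⁻¹ := by
        rw [show (4 : ℝ) = 2 * 2 by norm_num, mul_pow]; ring
    _ ≤ deltad d * (v i)⁻¹ := by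
        have := hv i
        apply mul_le_mul_of_nonneg_right _ (by positivity)
        unfold deltad
        have h1 : (1 : ℝ) ≤ d := by
          have := i.isLt
          exact_mod_cast (by omega : 1 ≤ d)
        exact le_mul_of_one_le_left (by positivity) h1

/-- Lemma: rows of the inverse transpose are short: if M = n(u)a(v)k
in Siegel coordinates and v_i > δ_d 2^{l_i} for i ≤ s, then the i-th row β_i of
(Mᵀ)⁻¹ satisfies ‖β_i‖ ≤ δ_d v_i⁻¹ < 2^{-l_i}. -/
theorem stmt8 (d : ℕ) (hd : 2 ≤ d) (u : Fin d → Fin d → ℝ)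
    (hu : ∀ i j : Fin d, i < j → |u i j| ≤ 1 / 2)
    (v : Fin d → ℝ) (hv : ∀ i, 0 < v i) (hv1 : ∏ i, v i = 1)
    (hvchain : ∀ i j : Fin d, (i : ℕ) + 1 = (j : ℕ) → v j ≤ 2 / Real.sqrt 3 * v i)
    (k : Matrix (Fin d) (Fin d) ℝ) (hk : k * kᵀ = 1) (hkdet : k.det = 1)
    (s : ℕ) (hs1 : 1 ≤ s) (hs2 : s ≤ d - 1)
    (l : Fin d → ℕ)
    (hvl : ∀ i : Fin d, (i : ℕ) < s → deltad d * 2 ^ (l i) < v i) :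
    ∀ i : Fin d, (i : ℕ) < s →
      enorm' (Matrix.vecMul (Pi.single i 1)
          (((nMat d u * Matrix.diagonal v * k)ᵀ)⁻¹)) ≤ deltad d * (v i)⁻¹ ∧
      deltad d * (v i)⁻¹ < ((2:ℝ) ^ (l i))⁻¹ := by
  intro i hi
  refine ⟨aux_main u hu v hv hv1 hvchain k hk hkdet i, ?_⟩
  have h := hvl i hi
  have h0 := hv i
  have h2 : (0 : ℝ) < 2 ^ l i := by positivity
  rw [← div_eq_mul_inv, div_lt_iff₀ h0, ← div_eq_inv_mul, lt_div_iff₀ h2]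
  exact h

end
end

section
/- Let d ≥ 2, ξ ∈ ℝ^d, M0 ∈ SL(d,ℝ), η, r > 0, and let ψ : ℝ^{d−1} → ℝ be continuous with compact support. Assume one of: (B1) η < d; (B2) η < d+1 and, if d = 2, Σ_{l=1}^∞ 2^{(η−2)l} ζ(ξ,2^{l−1})^{−2} < ∞, while if d ≥ 3, Σ_{l=1}^∞ l^{d−1} 2^{(η−d)l} ζ(ξ,2^{l−1})^{−1} < ∞. Then lim_{R→∞} limsup_{t→∞} | ∫_{ℝ^{d−1}} F_{R,η,r}( Γ' (1,ξ)(M0 ñ(y) Φ_t, 0) ) ψ(y) dy | = 0. -/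
open MeasureTheory Filter Matrix
open scoped Topology Classical

noncomputable section

abbrev EE (d : ℕ) := EuclideanSpace ℝ (Fin d)

def regn {d : ℕ} (W : Submodule ℝ (EE d)) (a b : ℝ) : Set (EE d) :=
  {z | ‖W.starProjection z‖ ≤ a ∧ ‖Wᗮ.starProjection z‖ ≤ b}

lemma regn_vol_eq {d : ℕ} (W : Submodule ℝ (EE d)) (a b : ℝ) (ha : 0 ≤ a) (hb : 0 ≤ b) :
    volume (regn W a b) = ENNReal.ofReal (a ^ (Module.finrank ℝ W)) *
      ENNReal.ofReal (b ^ (d - Module.finrank ℝ W)) *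
      (volume (Metric.closedBall (0 : W) 1) * volume (Metric.closedBall (0 : Wᗮ) 1)) := by
  have h1 := (WithLp.volume_preserving_ofLp (U := W) (V := Wᗮ)).comp
    (W.orthogonalDecomposition.measurePreserving)
  have h2 : regn W a b = (fun z => WithLp.ofLp (W.orthogonalDecomposition z)) ⁻¹'
      (Metric.closedBall (0 : W) a ×ˢ Metric.closedBall (0 : Wᗮ) b) := by
    ext z
    simp only [regn, Set.mem_setOf_eq, Set.mem_preimage, Set.mem_prod, mem_closedBall_zero_iff]
    have e1 := Submodule.fst_orthogonalDecomposition_apply (K := W) (x := z)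
    have e2 := Submodule.snd_orthogonalDecomposition_apply (K := W) (x := z)
    change _ ↔ ‖(W.orthogonalDecomposition z).fst‖ ≤ a ∧ ‖(W.orthogonalDecomposition z).snd‖ ≤ b
    rw [e1, e2]
    rfl
  have h3 : Module.finrank ℝ Wᗮ = d - Module.finrank ℝ W := by
    have := W.finrank_add_finrank_orthogonal
    rw [finrank_euclideanSpace_fin] at this
    omega
  rw [h2]
  have h4 := h1.measure_preimage (s := Metric.closedBall (0 : W) a ×ˢ Metric.closedBall (0 : Wᗮ) b)
    (Metric.isClosed_closedBall.measurableSet.prod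
      Metric.isClosed_closedBall.measurableSet).nullMeasurableSet
  refine h4.trans ?_
  rw [Measure.volume_eq_prod, Measure.prod_prod, Measure.addHaar_closedBall' _ _ ha,
    Measure.addHaar_closedBall' _ _ hb, h3]
  ring

lemma regn_vol_le {d : ℕ} (W : Submodule ℝ (EE d)) (a b : ℝ) (ha : 0 ≤ a) (hb : 0 ≤ b) :
    volume (regn W a b) ≤ ENNReal.ofReal (a ^ (Module.finrank ℝ W)) *
      ENNReal.ofReal (b ^ (d - Module.finrank ℝ W)) *
      volume (Metric.closedBall (0 : EE d) 2) := by
  rw [regn_vol_eq W a b ha hb]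
  gcongr
  have := regn_vol_eq W 1 1 zero_le_one zero_le_one
  simp only [one_pow, ENNReal.ofReal_one, one_mul] at this
  rw [← this]
  apply measure_mono
  intro z hz
  have h : z = W.starProjection z + Wᗮ.starProjection z :=
    (Submodule.starProjection_add_starProjection_orthogonal z).symm
  rw [mem_closedBall_zero_iff, h]
  refine (norm_add_le _ _).trans ?_
  have := hz.1
  have := hz.2
  linarith

/-- packing constant -/
lemma packing (d : ℕ) : ∃ C : ℝ, 0 < C ∧ ∀ (W : Submodule ℝ (EE d)) (Z a b : ℝ), 0 < Z → 0 ≤ a →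
    0 ≤ b → ∀ (ι : Type) (T : Finset ι) (f : ι → EE d),
    (∀ x ∈ T, ∀ y ∈ T, x ≠ y → Z ≤ dist (f x) (f y)) → (∀ x ∈ T, f x ∈ regn W a b) →
    (T.card : ℝ) * Z ^ d ≤ C * (a + Z) ^ (Module.finrank ℝ W) *
      (b + Z) ^ (d - Module.finrank ℝ W) := by
  set K := volume (Metric.closedBall (0 : EE d) 2) with hK
  set k := volume (Metric.ball (0 : EE d) (1/2)) with hk
  have hk0 : 0 < k := Metric.measure_ball_pos _ _ (by norm_num)
  have hkt : k ≠ ⊤ := measure_ball_lt_top.ne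
  have hKt : K ≠ ⊤ := measure_closedBall_lt_top.ne
  have hK0 : 0 < K := Metric.measure_closedBall_pos _ _ (by norm_num)
  refine ⟨K.toReal / k.toReal, div_pos (ENNReal.toReal_pos hK0.ne' hKt)
    (ENNReal.toReal_pos hk0.ne' hkt), ?_⟩
  intro W Z a b hZ ha hb ι T f hsep hreg
  have h1 : volume (⋃ x ∈ T, Metric.ball (f x) (Z / 2)) =
      ∑ x ∈ T, volume (Metric.ball (f x) (Z / 2)) := by
    apply measure_biUnion_finset
    · intro x hx y hy hxy
      apply Metric.ball_disjoint_ball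
      have := hsep x hx y hy hxy
      linarith
    · intro x _
      exact Metric.isOpen_ball.measurableSet
  have h2 : ∀ x, volume (Metric.ball (f x) (Z / 2)) = ENNReal.ofReal (Z ^ d) * k := by
    intro x
    have := Measure.addHaar_ball_mul_of_pos (volume : Measure (EE d)) (f x) hZ (1/2)
    rw [finrank_euclideanSpace_fin] at this
    rw [← this]
    congr 2; ring
  have h3 : (⋃ x ∈ T, Metric.ball (f x) (Z / 2)) ⊆ regn W (a + Z) (b + Z) := by
    intro z hz
    simp only [Set.mem_iUnion] at hz
    obtain ⟨x, hx, hz⟩ := hz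
    have hd : ‖z - f x‖ < Z / 2 := by rwa [← dist_eq_norm]
    have hr := hreg x hx
    have key : ∀ V : Submodule ℝ (EE d), ‖V.starProjection z‖ ≤ ‖V.starProjection (f x)‖ + Z := by
      intro V
      have e : V.starProjection z = V.starProjection (f x) + V.starProjection (z - f x) := by
        rw [← map_add]; congr 1; abel
      rw [e]
      refine (norm_add_le _ _).trans ?_
      have := V.norm_starProjection_apply_le (z - f x)
      linarith
    exact ⟨(key W).trans (by linarith [hr.1]), (key _).trans (by linarith [hr.2])⟩
  have h4 := (measure_mono h3).trans (regn_vol_le W (a + Z) (b + Z) (by linarith) (by linarith))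
  rw [h1, Finset.sum_congr rfl (fun x _ => h2 x), Finset.sum_const, nsmul_eq_mul] at h4
  have h5 := ENNReal.toReal_mono (by
    apply ENNReal.mul_ne_top (ENNReal.mul_ne_top ENNReal.ofReal_ne_top ENNReal.ofReal_ne_top) hKt) h4
  simp only [ENNReal.toReal_mul, ENNReal.toReal_natCast] at h5
  rw [ENNReal.toReal_ofReal (by positivity), ENNReal.toReal_ofReal (by positivity),
    ENNReal.toReal_ofReal (by positivity)] at h5
  have hkp : 0 < k.toReal := ENNReal.toReal_pos hk0.ne' hkt
  have : (T.card : ℝ) * Z ^ d * k.toReal ≤ K.toReal * (a + Z) ^ (Module.finrank ℝ W) *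
      (b + Z) ^ (d - Module.finrank ℝ W) := by linarith
  calc (T.card : ℝ) * Z ^ d ≤ (K.toReal * (a + Z) ^ (Module.finrank ℝ W) *
      (b + Z) ^ (d - Module.finrank ℝ W)) / k.toReal := (le_div_iff₀ hkp).2 this
    _ = _ := by ring

lemma sum_inv_le {ι : Type} (ρ : ι → ℝ) (g : ℕ → ℝ) (T : Finset ι)
    (h : ∀ T' ⊆ T, ∀ a ∈ T', (∀ q ∈ T', ρ q ≤ ρ a) → 1 / ρ a ≤ g T'.card - g (T'.card - 1)) :
    ∑ q ∈ T, 1 / ρ q ≤ g T.card - g 0 := by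
  induction hn : T.card generalizing T with
  | zero =>
    rw [Finset.card_eq_zero] at hn
    subst hn; simp
  | succ n ih =>
    have hne : T.Nonempty := by rw [← Finset.card_pos]; omega
    obtain ⟨a, ha, hmax⟩ := T.exists_max_image ρ hne
    have h1 := h T (Finset.Subset.refl _) a ha hmax
    have hc : (T.erase a).card = n := by rw [Finset.card_erase_of_mem ha]; omega
    have h2 := ih (T.erase a) (fun T' hT' => h T' (hT'.trans (Finset.erase_subset _ _))) hc
    rw [← Finset.add_sum_erase T _ ha]
    rw [hn] at h1
    simp only [Nat.add_sub_cancel] at h1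
    linarith

lemma sum_inv_log {ι : Type} (ρ : ι → ℝ) (B : ℝ) (hB : 0 ≤ B) (T : Finset ι)
    (hpos : ∀ q ∈ T, 0 < ρ q)
    (h : ∀ T' ⊆ T, ∀ a ∈ T', (∀ q ∈ T', ρ q ≤ ρ a) → (T'.card : ℝ) ≤ B * ρ a) :
    ∑ q ∈ T, 1 / ρ q ≤ B * (1 + Real.log T.card) := by
  have := sum_inv_le ρ (fun n => if n = 0 then 0 else B * (1 + Real.log n)) T ?_
  · refine this.trans ?_
    by_cases h0 : T.card = 0
    · simp [h0, hB]
    · simp [h0]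
  · intro T' hT' a ha hmax
    have hc := h T' hT' a ha hmax
    have hp := hpos a (hT' ha)
    have hne : T'.card ≠ 0 := (Finset.card_pos.2 ⟨a, ha⟩).ne'
    obtain ⟨n, hn⟩ := Nat.exists_eq_succ_of_ne_zero hne
    rw [hn] at hc ⊢
    have h1 : 1 / ρ a ≤ B / (n + 1) := by
      rw [div_le_div_iff₀ hp (by positivity)]
      push_cast at hc
      linarith
    simp only [Nat.succ_eq_add_one, Nat.add_sub_cancel]
    by_cases h0 : n = 0
    · subst h0; simpa using h1
    · have hn0 : (0 : ℝ) < n := by positivity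
      simp only [h0, if_false, Nat.add_eq_zero_iff, one_ne_zero, and_false]
      have h2 : 1 / ((n : ℝ) + 1) ≤ Real.log (n + 1) - Real.log n := by
        rw [← Real.log_div (by positivity) (by positivity)]
        have := Real.one_sub_inv_le_log_of_pos (x := ((n : ℝ) + 1) / n) (by positivity)
        refine le_trans (le_of_eq ?_) this
        field_simp
        ring
      push_cast
      calc 1 / ρ a ≤ B * (1 / (n + 1)) := by rw [mul_one_div]; exact h1
        _ ≤ B * (Real.log (n + 1) - Real.log n) := by gcongr
        _ = _ := by ring

lemma sum_inv_sqrt {ι : Type} (ρ : ι → ℝ) (B : ℝ) (hB : 0 ≤ B) (T : Finset ι)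
    (hpos : ∀ q ∈ T, 0 < ρ q)
    (h : ∀ T' ⊆ T, ∀ a ∈ T', (∀ q ∈ T', ρ q ≤ ρ a) → (T'.card : ℝ) ≤ B * ρ a ^ 2) :
    ∑ q ∈ T, 1 / ρ q ≤ 2 * Real.sqrt (B * T.card) := by
  have := sum_inv_le ρ (fun n => 2 * Real.sqrt (B * n)) T ?_
  · simpa using this
  · intro T' hT' a ha hmax
    have hc := h T' hT' a ha hmax
    have hp := hpos a (hT' ha)
    have hne : T'.card ≠ 0 := (Finset.card_pos.2 ⟨a, ha⟩).ne'
    obtain ⟨n, hn⟩ := Nat.exists_eq_succ_of_ne_zero hne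
    rw [hn] at hc ⊢
    push_cast at hc
    simp only [Nat.succ_eq_add_one, Nat.add_sub_cancel]
    push_cast
    have hn0 : (0 : ℝ) ≤ n := by positivity
    set x := Real.sqrt (B * (n + 1)) with hx
    set y := Real.sqrt (B * n) with hy
    have hx2 : x ^ 2 = B * (n + 1) := Real.sq_sqrt (by positivity)
    have hy2 : y ^ 2 = B * n := Real.sq_sqrt (by positivity)
    have hx0 : 0 ≤ x := Real.sqrt_nonneg _
    have hy0 : 0 ≤ y := Real.sqrt_nonneg _
    have hyx : y ≤ x := Real.sqrt_le_sqrt (by nlinarith)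
    have hxB : x ≤ B * ρ a := by
      apply Real.sqrt_le_iff.2
      refine ⟨by positivity, ?_⟩
      nlinarith
    have hBp : 0 < B := by
      by_contra hcon
      have : B = 0 := le_antisymm (not_lt.1 hcon) hB
      rw [this] at hc
      linarith
    rw [div_le_iff₀ hp]
    have h3 : B = (x - y) * (x + y) := by nlinarith
    have h4 : B ≤ (x - y) * (2 * (B * ρ a)) := by
      calc B = (x - y) * (x + y) := h3
        _ ≤ _ := by
          apply mul_le_mul_of_nonneg_left _ (by linarith)
          linarith
    have h5 : B * 1 ≤ B * ((2 * x - 2 * y) * ρ a) := by linarith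
    exact le_of_mul_le_mul_left h5 hBp

def iv {d : ℕ} (q : Fin d → ℤ) : EE d := WithLp.toLp 2 (fun i => (q i : ℝ))

lemma iv_add {d : ℕ} (q q' : Fin d → ℤ) : iv (q + q') = iv q + iv q' := by
  ext i; simp [iv]
lemma iv_sub {d : ℕ} (q q' : Fin d → ℤ) : iv (q - q') = iv q - iv q' := by
  ext i; simp [iv]
lemma iv_zsmul {d : ℕ} (c : ℤ) (q : Fin d → ℤ) : iv (c • q) = (c : ℝ) • iv q := by
  ext i; simp [iv]
lemma iv_sum {d : ℕ} {ι : Type} (s : Finset ι) (f : ι → Fin d → ℤ) :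
    iv (∑ i ∈ s, f i) = ∑ i ∈ s, iv (f i) := by
  induction s using Finset.induction_on with
  | empty => ext i; simp [iv]
  | insert a s ha ih => rw [Finset.sum_insert ha, Finset.sum_insert ha, iv_add, ih]

lemma iv_norm_ge {d : ℕ} (q : Fin d → ℤ) (i : Fin d) : (|q i| : ℝ) ≤ ‖iv q‖ := by
  have := PiLp.norm_apply_le (iv q) i
  simpa [iv, Real.norm_eq_abs] using this

lemma iv_norm_ge_one {d : ℕ} (q : Fin d → ℤ) (h : q ≠ 0) : 1 ≤ ‖iv q‖ := by
  obtain ⟨i, hi⟩ := Function.ne_iff.1 h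
  refine le_trans ?_ (iv_norm_ge q i)
  have : (1 : ℤ) ≤ |q i| := Int.one_le_abs hi
  exact_mod_cast this

lemma iv_dist_ge_one {d : ℕ} (q q' : Fin d → ℤ) (h : q ≠ q') : 1 ≤ dist (iv q) (iv q') := by
  rw [dist_eq_norm, ← iv_sub]
  exact iv_norm_ge_one _ (sub_ne_zero.2 h)

abbrev WW {d : ℕ} (Q : Finset (Fin d → ℤ)) : Submodule ℝ (EE d) :=
  Submodule.span ℝ (iv '' (Q : Set (Fin d → ℤ)))

abbrev rho {d : ℕ} (W : Submodule ℝ (EE d)) (q : Fin d → ℤ) : ℝ := ‖Wᗮ.starProjection (iv q)‖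

lemma reduce_mod {d : ℕ} (Q : Finset (Fin d → ℤ)) (X : ℝ) (hQ : ∀ q ∈ Q, ‖iv q‖ ≤ X)
    (w : EE d) (hw : w ∈ WW Q) : ∃ r : Fin d → ℤ, iv r ∈ WW Q ∧ ‖w - iv r‖ ≤ Q.card * X := by
  obtain ⟨c, hc⟩ := (Submodule.mem_span_image_finset_iff_exists_fun' ℝ).1 hw
  refine ⟨∑ q ∈ Q, ⌊c q⌋ • q, ?_, ?_⟩
  · rw [iv_sum]
    apply Submodule.sum_mem
    intro q hq
    rw [iv_zsmul]
    exact Submodule.smul_mem _ _ (Submodule.subset_span ⟨q, hq, rfl⟩)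
  · rw [iv_sum, ← hc, ← Finset.sum_sub_distrib]
    refine (norm_sum_le _ _).trans ?_
    rw [← nsmul_eq_mul]
    apply Finset.sum_le_card_nsmul
    intro q hq
    rw [iv_zsmul, ← sub_smul, norm_smul]
    have h1 : ‖c q - (⌊c q⌋ : ℝ)‖ ≤ 1 := by
      rw [Real.norm_eq_abs, abs_le]
      have := Int.floor_le (c q)
      have := Int.lt_floor_add_one (c q)
      constructor <;> linarith
    calc _ ≤ 1 * ‖iv q‖ := by gcongr
      _ ≤ X := by rw [one_mul]; exact hQ q hq

lemma finrank_WW {d : ℕ} (Q : Finset (Fin d → ℤ)) : Module.finrank ℝ (WW Q) ≤ Q.card := by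
  have h := finrank_span_finset_le_card (R := ℝ) (Q.image iv)
  rw [Finset.coe_image] at h
  exact h.trans Finset.card_image_le

lemma starProjection_orth_of_mem {d : ℕ} (W : Submodule ℝ (EE d)) (w : EE d) (hw : w ∈ W) :
    Wᗮ.starProjection w = 0 := by
  rw [Submodule.starProjection_apply_eq_zero_iff]
  exact Submodule.le_orthogonal_orthogonal _ hw

lemma rho_le {d : ℕ} (W : Submodule ℝ (EE d)) (q : Fin d → ℤ) : rho W q ≤ ‖iv q‖ :=
  Submodule.norm_starProjection_apply_le _ _

lemma small_count (d : ℕ) : ∃ C : ℝ, 0 < C ∧ ∀ (Q : Finset (Fin d → ℤ)) (X : ℝ), 1 ≤ X →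
    Q.card ≤ d → (∀ q ∈ Q, ‖iv q‖ ≤ X) → ∀ (T : Finset (Fin d → ℤ)), (∀ q ∈ T, ‖iv q‖ ≤ X) →
    ∀ a ∈ T, 0 < rho (WW Q) a → rho (WW Q) a ≤ 1 → (∀ q ∈ T, rho (WW Q) q ≤ rho (WW Q) a) →
    (T.card : ℝ) ≤ C * X ^ (Module.finrank ℝ (WW Q)) * rho (WW Q) a := by
  obtain ⟨C, hC, hpack⟩ := packing d
  refine ⟨2 * (C * (d + 2) ^ d * 5 ^ d), by positivity, ?_⟩
  intro Q X hX hQd hQ T hT a ha hρ0 hρ1 hmax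
  set W := WW Q with hW
  set ρ := rho W a with hρ
  have hred : ∀ k : ℕ, ∃ r : Fin d → ℤ, iv r ∈ W ∧
      ‖W.starProjection (iv ((3 * k : ℤ) • a)) - iv r‖ ≤ Q.card * X := fun k =>
    reduce_mod Q X hQ _ (Submodule.starProjection_apply_mem _ _)
  choose r hrW hr using hred
  set K := ⌊1 / ρ⌋₊ with hK
  have hK1 : 1 ≤ 1 / ρ := by rw [le_div_iff₀ hρ0]; linarith
  have hKρ : (K : ℝ) * ρ ≤ 1 := by
    have := Nat.floor_le (a := 1 / ρ) (by positivity)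
    rwa [le_div_iff₀ hρ0] at this
  have hK2 : 1 ≤ 2 * ρ * K := by
    have h1 := Nat.lt_floor_add_one (1 / ρ)
    have h2 : (1 : ℝ) ≤ K := by
      have : 1 ≤ K := Nat.le_floor (by simpa using hK1)
      exact_mod_cast this
    have h3 : 1 / ρ ≤ 2 * K := by linarith
    rw [div_le_iff₀ hρ0] at h3
    linarith
  let f0 : (Fin d → ℤ) × ℕ → (Fin d → ℤ) := fun p => p.1 + (3 * p.2 : ℤ) • a - r p.2
  have horth : ∀ p, Wᗮ.starProjection (iv (f0 p)) = Wᗮ.starProjection (iv p.1) +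
      (3 * p.2 : ℝ) • Wᗮ.starProjection (iv a) := by
    intro p
    simp only [f0]
    rw [iv_sub, iv_add, iv_zsmul, map_sub, map_add, map_smul, starProjection_orth_of_mem W _ (hrW _)]
    push_cast
    simp
  have hinj : ∀ p ∈ T ×ˢ Finset.range K, ∀ p' ∈ T ×ˢ Finset.range K, f0 p = f0 p' → p = p' := by
    intro p hp p' hp' hf
    rw [Finset.mem_product] at hp hp'
    have e1 := horth p
    have e2 := horth p'
    rw [hf, e2] at e1
    have e3 : ((3 * p'.2 : ℝ) - 3 * p.2) • Wᗮ.starProjection (iv a) =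
        Wᗮ.starProjection (iv p.1) - Wᗮ.starProjection (iv p'.1) := by
      rw [sub_smul, sub_eq_sub_iff_add_eq_add, add_comm, e1]
    have e4 := congrArg norm e3
    rw [norm_smul] at e4
    have e5 : |(3 * p'.2 : ℝ) - 3 * p.2| * ρ ≤ 2 * ρ := by
      calc _ = _ := e4
        _ ≤ _ := norm_sub_le _ _
        _ ≤ ρ + ρ := add_le_add (hmax _ hp.1) (hmax _ hp'.1)
        _ = _ := by ring
    have e6 : |(3 * p'.2 : ℝ) - 3 * p.2| ≤ 2 := le_of_mul_le_mul_right e5 hρ0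
    have e7 : |(3 * p'.2 : ℤ) - 3 * p.2| ≤ 2 := by exact_mod_cast e6
    have e8 : p.2 = p'.2 := by
      rw [abs_le] at e7; omega
    refine Prod.ext ?_ e8
    simp only [f0] at hf
    rw [e8] at hf
    simpa using hf
  have hcount := hpack W 1 ((d + 1) * X) 4 one_pos (by positivity) (by norm_num)
    ((Fin d → ℤ) × ℕ) (T ×ˢ Finset.range K) (fun p => iv (f0 p)) ?_ ?_
  · rw [Finset.card_product, Finset.card_range] at hcount
    push_cast at hcount
    have hn : Module.finrank ℝ W ≤ d := (finrank_WW Q).trans hQd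
    have h1 : ((d + 1) * X + 1 : ℝ) ^ (Module.finrank ℝ W) ≤
        (d + 2) ^ d * X ^ (Module.finrank ℝ W) := by
      calc ((d + 1) * X + 1 : ℝ) ^ (Module.finrank ℝ W) ≤ ((d + 2) * X) ^ (Module.finrank ℝ W) := by
            gcongr; nlinarith
        _ = (d + 2 : ℝ) ^ (Module.finrank ℝ W) * X ^ (Module.finrank ℝ W) := by rw [mul_pow]
        _ ≤ _ := by
          gcongr
          have : (0 : ℝ) ≤ d := by positivity
          linarith
    have h2 : ((4 : ℝ) + 1) ^ (d - Module.finrank ℝ W) ≤ 5 ^ d := by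
      rw [show (4 : ℝ) + 1 = 5 by norm_num]
      exact pow_le_pow_right₀ (by norm_num) (by omega)
    have h3 : (T.card : ℝ) * K ≤ C * (d + 2) ^ d * 5 ^ d * X ^ (Module.finrank ℝ W) := by
      calc (T.card : ℝ) * K = T.card * K * 1 ^ d := by simp
        _ ≤ _ := hcount
        _ ≤ C * ((d + 2) ^ d * X ^ (Module.finrank ℝ W)) * 5 ^ d := by gcongr
        _ = _ := by ring
    calc (T.card : ℝ) ≤ T.card * (2 * ρ * K) := by
          have : (0 : ℝ) ≤ T.card := by positivity
          nlinarith
      _ = 2 * ρ * (T.card * K) := by ring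
      _ ≤ 2 * ρ * (C * (d + 2) ^ d * 5 ^ d * X ^ (Module.finrank ℝ W)) := by gcongr
      _ = _ := by ring
  · intro p hp p' hp' hne
    apply iv_dist_ge_one
    intro h
    exact hne (hinj p hp p' hp' h)
  · intro p hp
    rw [Finset.mem_product, Finset.mem_range] at hp
    constructor
    · have e : W.starProjection (iv (f0 p)) = W.starProjection (iv p.1) +
          (W.starProjection (iv ((3 * p.2 : ℤ) • a)) - iv (r p.2)) := by
        simp only [f0]
        rw [iv_sub, iv_add, map_sub, map_add, Submodule.starProjection_eq_self_iff.2 (hrW p.2)]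
        abel
      rw [e]
      refine (norm_add_le _ _).trans ?_
      have h1 := (Submodule.norm_starProjection_apply_le W (iv p.1)).trans (hT _ hp.1)
      have h2 := hr p.2
      have h3 : (Q.card : ℝ) * X ≤ d * X := by gcongr
      linarith
    · rw [horth]
      refine (norm_add_le _ _).trans ?_
      rw [norm_smul, Real.norm_of_nonneg (by positivity)]
      have h1 := hmax _ hp.1
      have h2 : (p.2 : ℝ) * ρ ≤ K * ρ := by
        gcongr
        exact hp.2.le
      change rho W p.1 + 3 * (p.2 : ℝ) * ρ ≤ 4
      linarith

lemma rho_pos {d : ℕ} (W : Submodule ℝ (EE d)) (q : Fin d → ℤ) (h : iv q ∉ W) : 0 < rho W q := by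
  rw [norm_pos_iff]
  intro h0
  rw [Submodule.starProjection_apply_eq_zero_iff, Submodule.orthogonal_orthogonal] at h0
  exact h h0

lemma step_sum (d : ℕ) (hd : 2 ≤ d) : ∃ C : ℝ, 0 < C ∧ ∀ e : ℕ, (e = 1 ∨ (e = 2 ∧ d = 2)) →
    ∀ (Q : Finset (Fin d → ℤ)) (X Z : ℝ), 0 ≤ X → 1 ≤ Z → Q.card ≤ d - 2 →
    (∀ q ∈ Q, ‖iv q‖ ≤ X) → ∀ (T : Finset (Fin d → ℤ)), (∀ q ∈ T, ‖iv q‖ ≤ X) →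
    (∀ q ∈ T, iv q ∉ WW Q) → (∀ q ∈ T, Z ≤ ‖iv q‖) →
    (∀ x ∈ T, ∀ y ∈ T, x ≠ y → Z ≤ dist (iv x) (iv y)) →
    ∑ q ∈ T, 1 / rho (WW Q) q ≤ C * (X ^ (d - 1) / Z ^ e) := by
  obtain ⟨C₀, hC₀, hpack⟩ := packing d
  obtain ⟨C₃, hC₃, hsmall⟩ := small_count d
  set D : ℝ := C₀ * 2 ^ d with hD
  have hDp : 0 < D := by positivity
  refine ⟨2 * D + D + C₃ * (1 + D + d), by positivity, ?_⟩
  intro e he Q X Z hX0 hZ hQc hQ T hT hTW hTZ hsep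
  rcases T.eq_empty_or_nonempty with hTe | ⟨q0, hq0⟩
  · subst hTe
    simp only [Finset.sum_empty]
    positivity
  have hXZ : Z ≤ X := (hTZ q0 hq0).trans (hT q0 hq0)
  have hZ0 : 0 < Z := by linarith
  have hX : 1 ≤ X := by linarith
  set W := WW Q with hW
  set n := Module.finrank ℝ W with hn
  have hnd : n ≤ d - 2 := (finrank_WW Q).trans hQc
  have hρ : ∀ q ∈ T, 0 < rho W q := fun q hq => rho_pos W q (hTW q hq)
  have hcount : ∀ T' ⊆ T, ∀ β : ℝ, Z ≤ β → (∀ q ∈ T', rho W q ≤ β) →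
      (T'.card : ℝ) * Z ^ d ≤ D * X ^ n * β ^ (d - n) := by
    intro T' hT' β hβ hb
    have h := hpack W Z X β hZ0 hX0 (by linarith) _ T' iv
      (fun x hx y hy hxy => hsep x (hT' hx) y (hT' hy) hxy)
      (fun x hx => ⟨(Submodule.norm_starProjection_apply_le _ _).trans (hT x (hT' hx)), hb x hx⟩)
    refine h.trans ?_
    have hβ0 : 0 ≤ β := by linarith
    calc C₀ * (X + Z) ^ n * (β + Z) ^ (d - n) ≤ C₀ * (2 * X) ^ n * (2 * β) ^ (d - n) := by
          gcongr <;> linarith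
      _ = C₀ * (2 ^ n * 2 ^ (d - n)) * X ^ n * β ^ (d - n) := by rw [mul_pow, mul_pow]; ring
      _ = _ := by rw [← pow_add, show n + (d - n) = d by omega]
  have hed : e ≤ d := by rcases he with h | h <;> omega
  -- part one
  set T1 := T.filter (fun q => Z ≤ rho W q) with hT1
  set T4 := T.filter (fun q => ¬ Z ≤ rho W q) with hT4
  have hT1s : T1 ⊆ T := Finset.filter_subset _ _
  have hT4s : T4 ⊆ T := Finset.filter_subset _ _
  set B := D * X ^ (d - 2) / Z ^ d with hB
  have hBp : 0 ≤ B := by positivity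
  have hc1 : ∀ T' ⊆ T1, ∀ β : ℝ, Z ≤ β → β ≤ X → (∀ q ∈ T', rho W q ≤ β) →
      (T'.card : ℝ) ≤ B * β ^ 2 := by
    intro T' hT' β h1 h2 h3
    have := hcount T' (hT'.trans hT1s) β h1 h3
    have h4 : D * X ^ n * β ^ (d - n) ≤ D * X ^ (d - 2) * β ^ 2 := by
      calc D * X ^ n * β ^ (d - n) = D * X ^ n * (β ^ (d - 2 - n) * β ^ 2) := by
            rw [← pow_add]; congr 2; omega
        _ ≤ D * X ^ n * (X ^ (d - 2 - n) * β ^ 2) := by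
            have : 0 ≤ β := by linarith
            gcongr
        _ = D * (X ^ (n + (d - 2 - n))) * β ^ 2 := by rw [pow_add]; ring
        _ = _ := by rw [show n + (d - 2 - n) = d - 2 by omega]
    rw [hB, div_mul_eq_mul_div, le_div_iff₀ (by positivity)]
    exact this.trans h4
  have hs1 : ∑ q ∈ T1, 1 / rho W q ≤ 2 * D * (X ^ (d - 1) / Z ^ e) := by
    have h1 := sum_inv_sqrt (rho W) B hBp T1 (fun q hq => hρ q (hT1s hq)) (by
      intro T' hT' a ha hmax
      have haT := hT' ha
      rw [hT1, Finset.mem_filter] at haT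
      exact hc1 T' hT' (rho W a) haT.2 ((rho_le W a).trans (hT a haT.1)) hmax)
    have h2 := hc1 T1 (Finset.Subset.refl _) X hXZ le_rfl
      (fun q hq => (rho_le W q).trans (hT q (hT1s hq)))
    have h3 : Real.sqrt (B * T1.card) ≤ B * X := by
      apply Real.sqrt_le_iff.2
      refine ⟨by positivity, ?_⟩
      calc B * T1.card ≤ B * (B * X ^ 2) := by gcongr
        _ = _ := by ring
    refine h1.trans ?_
    calc 2 * Real.sqrt (B * T1.card) ≤ 2 * (B * X) := by gcongr
      _ = 2 * D * (X ^ (d - 2 + 1) / Z ^ d) := by rw [hB, pow_succ]; ring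
      _ = 2 * D * (X ^ (d - 1) / Z ^ d) := by rw [show d - 2 + 1 = d - 1 by omega]
      _ ≤ _ := by gcongr
  have hs4 : ∑ q ∈ T4, 1 / rho W q ≤ (D + C₃ * (1 + D + d)) * (X ^ (d - 1) / Z ^ e) := by
    rcases T4.eq_empty_or_nonempty with hTe | ⟨q4, hq4⟩
    · rw [hTe]; simp only [Finset.sum_empty]; positivity
    have hn0 : n ≠ 0 := by
      intro h0
      have hWb : W = ⊥ := Submodule.finrank_eq_zero.1 h0
      have h5 := (Finset.mem_filter.1 hq4).2
      apply h5
      have h6 : rho W q4 = ‖iv q4‖ := by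
        have : Wᗮ.starProjection (iv q4) = iv q4 := by
          rw [Submodule.starProjection_eq_self_iff, hWb]
          simp
        simp only [rho]
        rw [this]
      rw [h6]
      exact hTZ q4 (hT4s hq4)
    have he1 : e = 1 := by rcases he with h | h <;> omega
    rw [he1, pow_one]
    have hXZ1 : 1 ≤ X / Z := by rw [le_div_iff₀ hZ0]; linarith
    have hc4 : (T4.card : ℝ) ≤ D * (X / Z) ^ n := by
      have h6 := hcount T4 hT4s Z le_rfl (fun q hq => by
        have := (Finset.mem_filter.1 hq).2
        push Not at this; exact this.le)
      have h7 : (T4.card : ℝ) * Z ^ d ≤ (D * (X / Z) ^ n) * Z ^ d := by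
        refine h6.trans (le_of_eq ?_)
        have hzz : Z ^ d = Z ^ n * Z ^ (d - n) := by rw [← pow_add]; congr 1; omega
        rw [hzz, div_pow]
        field_simp
      exact le_of_mul_le_mul_right h7 (by positivity)
    set T2 := T4.filter (fun q => 1 ≤ rho W q) with hT2
    set T3 := T4.filter (fun q => ¬ 1 ≤ rho W q) with hT3
    have hT3s : T3 ⊆ T4 := Finset.filter_subset _ _
    have hXn : (X / Z) ^ n ≤ X ^ (d - 1) / Z := by
      calc (X / Z) ^ n ≤ (X / Z) ^ (d - 1) := pow_le_pow_right₀ hXZ1 (by omega)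
        _ = X ^ (d - 1) / Z ^ (d - 1) := div_pow _ _ _
        _ ≤ X ^ (d - 1) / Z ^ 1 := by gcongr; omega
        _ = _ := by rw [pow_one]
    have hs2 : ∑ q ∈ T2, 1 / rho W q ≤ D * (X ^ (d - 1) / Z) := by
      calc ∑ q ∈ T2, 1 / rho W q ≤ T2.card • (1 : ℝ) := by
            apply Finset.sum_le_card_nsmul
            intro q hq
            have := (Finset.mem_filter.1 hq).2
            rw [div_le_one (by linarith)]
            exact this
        _ = T2.card := by simp
        _ ≤ T4.card := by exact_mod_cast Finset.card_filter_le _ _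
        _ ≤ D * (X / Z) ^ n := hc4
        _ ≤ _ := by gcongr
    have hs3 : ∑ q ∈ T3, 1 / rho W q ≤ C₃ * (1 + D + d) * (X ^ (d - 1) / Z) := by
      rcases T3.eq_empty_or_nonempty with hTe | hne3
      · rw [hTe]; simp only [Finset.sum_empty]; positivity
      have h1 := sum_inv_log (rho W) (C₃ * X ^ n) (by positivity) T3
        (fun q hq => hρ q (hT4s (hT3s hq))) (by
          intro T' hT' a ha hmax
          have hTT : T' ⊆ T := hT'.trans (hT3s.trans hT4s)
          have h3 := (Finset.mem_filter.1 (hT' ha)).2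
          push Not at h3
          exact hsmall Q X hX (by omega) hQ T' (fun q hq => hT q (hTT hq)) a ha (hρ a (hTT ha))
            h3.le hmax)
      have hcp : (0 : ℝ) < T3.card := by exact_mod_cast Finset.card_pos.2 hne3
      have h2 : (T3.card : ℝ) ≤ D * (X / Z) ^ n := by
        refine le_trans ?_ hc4
        exact_mod_cast Finset.card_filter_le _ _
      have h3 : Real.log T3.card ≤ (D + d) * (X / Z) := by
        calc Real.log T3.card ≤ Real.log (D * (X / Z) ^ n) := Real.log_le_log hcp h2
          _ = Real.log D + n * Real.log (X / Z) := by
            rw [Real.log_mul hDp.ne' (by positivity), Real.log_pow]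
          _ ≤ D + d * (X / Z) := by
            have := Real.log_le_self hDp.le
            have h9 := Real.log_le_self (show 0 ≤ X / Z by positivity)
            have h8 : (n : ℝ) ≤ d := by exact_mod_cast (by omega : n ≤ d)
            have h10 : 0 ≤ Real.log (X / Z) := Real.log_nonneg hXZ1
            gcongr
          _ ≤ _ := by nlinarith
      refine h1.trans ?_
      calc C₃ * X ^ n * (1 + Real.log T3.card) ≤ C₃ * X ^ (d - 2) * ((1 + D + d) * (X / Z)) := by
            have : 0 ≤ Real.log T3.card := Real.log_natCast_nonneg _
            gcongr
            linarith
        _ = C₃ * (1 + D + d) * (X ^ (d - 2 + 1) / Z) := by rw [pow_succ]; ring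
        _ = _ := by rw [show d - 2 + 1 = d - 1 by omega]
    rw [← Finset.sum_filter_add_sum_filter_not T4 (fun q => 1 ≤ rho W q)]
    calc _ ≤ D * (X ^ (d - 1) / Z) + C₃ * (1 + D + d) * (X ^ (d - 1) / Z) := add_le_add hs2 hs3
      _ = _ := by ring
  rw [← Finset.sum_filter_add_sum_filter_not T (fun q => Z ≤ rho W q)]
  calc _ ≤ 2 * D * (X ^ (d - 1) / Z ^ e) + (D + C₃ * (1 + D + d)) * (X ^ (d - 1) / Z ^ e) :=
        add_le_add hs1 hs4
    _ = _ := by ring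

/-- the slab body -/
def EB {d : ℕ} (δ : ℕ → ℝ) (B : ℝ) (st : List (ℕ × (Fin d → ℤ))) : Set (EE d) :=
  {z | ‖z‖ ≤ B ∧ ∀ p ∈ st, |inner ℝ (iv p.2) z| ≤ δ p.1}

lemma EB_closed {d : ℕ} (δ : ℕ → ℝ) (B : ℝ) (st : List (ℕ × (Fin d → ℤ))) :
    IsClosed (EB δ B st) := by
  have : EB δ B st = {z | ‖z‖ ≤ B} ∩ ⋂ p ∈ {p | p ∈ st}, {z : EE d | |inner ℝ (iv p.2) z| ≤ δ p.1} := by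
    ext z; simp [EB]
  rw [this]
  refine (isClosed_le continuous_norm continuous_const).inter (isClosed_biInter fun p _ => ?_)
  exact isClosed_le (by fun_prop) continuous_const

def stQ {d : ℕ} (st : List (ℕ × (Fin d → ℤ))) : Finset (Fin d → ℤ) := (st.map Prod.snd).toFinset

lemma EB_step {d : ℕ} (δ : ℕ → ℝ) (hδ : ∀ l, 0 < δ l) (B : ℝ) (hB : 0 < B)
    (st : List (ℕ × (Fin d → ℤ))) (l : ℕ) (q : Fin d → ℤ) (hq : iv q ∉ WW (stQ st)) :
    volume (EB δ B ((l, q) :: st)) ≤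
      ENNReal.ofReal (3 * δ l / B * (1 / rho (WW (stQ st)) q)) * volume (EB δ (2 * B) st) := by
  set W := WW (stQ st) with hW
  set ρ := rho W q with hρ
  have hρ0 : 0 < ρ := rho_pos W q hq
  set u : EE d := Wᗮ.starProjection (iv q) with hu
  have huW : u ∈ Wᗮ := Submodule.starProjection_apply_mem _ _
  have hqu : inner ℝ (iv q) u = ρ ^ 2 := by
    have h1 : iv q = W.starProjection (iv q) + u :=
      (Submodule.starProjection_add_starProjection_orthogonal (iv q)).symm
    rw [h1, inner_add_left, real_inner_self_eq_norm_sq]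
    have : inner ℝ (W.starProjection (iv q)) u = 0 :=
      Submodule.inner_right_of_mem_orthogonal (Submodule.starProjection_apply_mem _ _) huW
    rw [this, zero_add]
  have hpu : ∀ p ∈ st, inner ℝ (iv p.2) u = 0 := by
    intro p hp
    apply Submodule.inner_right_of_mem_orthogonal _ huW
    apply Submodule.subset_span
    refine ⟨p.2, ?_, rfl⟩
    simp only [stQ, List.coe_toFinset, List.mem_map, Set.mem_ofPred_eq]
    exact ⟨p, hp, rfl⟩
  set K := ⌊B * ρ / (3 * δ l)⌋₊ with hK
  have hδl := hδ l
  have hK1 : B * ρ / (3 * δ l) ≤ (K + 1 : ℕ) := by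
    push_cast
    exact (Nat.lt_floor_add_one _).le
  have hK2 : (K : ℝ) * (3 * δ l) ≤ B * ρ := by
    have := Nat.floor_le (a := B * ρ / (3 * δ l)) (by positivity)
    rwa [le_div_iff₀ (by positivity)] at this
  let τ : ℕ → EE d := fun k => (3 * k * δ l / ρ ^ 2) • u
  have hqτ : ∀ k, inner ℝ (iv q) (τ k) = 3 * k * δ l := by
    intro k
    simp only [τ]
    rw [inner_smul_right, hqu]
    field_simp
  have hun : ‖u‖ = ρ := rfl
  have h1 : volume (⋃ k ∈ Finset.range (K + 1), (fun z => z + τ k) '' EB δ B ((l, q) :: st)) =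
      ∑ k ∈ Finset.range (K + 1), volume ((fun z => z + τ k) '' EB δ B ((l, q) :: st)) := by
    apply measure_biUnion_finset
    · intro k _ k' _ hkk
      rw [Function.onFun, Set.disjoint_left]
      rintro _ ⟨z, hz, rfl⟩ ⟨z', hz', hzz⟩
      apply hkk
      have e1 := congrArg (fun w => inner ℝ (iv q) w) hzz
      simp only [inner_add_right, hqτ] at e1
      have e2 := hz.2 (l, q) (by simp)
      have e3 := hz'.2 (l, q) (by simp)
      simp only at e2 e3
      rw [abs_le] at e2 e3
      have e4 : |(3 * k : ℝ) - 3 * k'| * δ l ≤ 2 * δ l := by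
        rw [← abs_of_pos hδl, ← abs_mul, abs_of_pos hδl, abs_le]
        constructor <;> linarith
      have e5 : |(3 * k : ℝ) - 3 * k'| ≤ 2 := le_of_mul_le_mul_right e4 hδl
      have e6 : |(3 * k : ℤ) - 3 * k'| ≤ 2 := by exact_mod_cast e5
      rw [abs_le] at e6; omega
    · intro k _
      rw [Set.image_add_right]
      exact (EB_closed _ _ _).measurableSet.preimage (by fun_prop)
  have h2 : ∀ k, volume ((fun z => z + τ k) '' EB δ B ((l, q) :: st)) =
      volume (EB δ B ((l, q) :: st)) := by
    intro k
    rw [Set.image_add_right, measure_preimage_add_right]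
  have h3 : (⋃ k ∈ Finset.range (K + 1), (fun z => z + τ k) '' EB δ B ((l, q) :: st)) ⊆
      EB δ (2 * B) st := by
    intro w hw
    simp only [Set.mem_iUnion] at hw
    obtain ⟨k, hk, z, hz, rfl⟩ := hw
    have hkK : k ≤ K := by simpa [Nat.lt_succ_iff] using hk
    constructor
    · refine (norm_add_le _ _).trans ?_
      have : ‖τ k‖ ≤ B := by
        simp only [τ]
        rw [norm_smul, Real.norm_of_nonneg (by positivity), hun]
        have e : 3 * k * δ l / ρ ^ 2 * ρ = k * (3 * δ l) / ρ := by field_simp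
        rw [e, div_le_iff₀ hρ0]
        refine le_trans ?_ hK2
        gcongr
      have := hz.1
      linarith
    · intro p hp
      have e := hz.2 p (by simp [hp])
      rw [inner_add_right]
      have e2 : inner ℝ (iv p.2) (τ k) = 0 := by
        simp only [τ]
        rw [inner_smul_right, hpu p hp, mul_zero]
      rw [e2, add_zero]
      exact e
  have h4 := measure_mono (μ := volume) h3
  rw [h1, Finset.sum_congr rfl (fun k _ => h2 k), Finset.sum_const, nsmul_eq_mul,
    Finset.card_range] at h4
  have h5 : (1 : ENNReal) ≤ ENNReal.ofReal (3 * δ l / B * (1 / ρ)) * ((K + 1 : ℕ) : ENNReal) := by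
    rw [← ENNReal.ofReal_natCast, ← ENNReal.ofReal_mul (by positivity), ENNReal.one_le_ofReal]
    calc (1 : ℝ) = 3 * δ l / B * (1 / ρ) * (B * ρ / (3 * δ l)) := by field_simp
      _ ≤ _ := by gcongr
  calc volume (EB δ B ((l, q) :: st)) = 1 * volume (EB δ B ((l, q) :: st)) := by rw [one_mul]
    _ ≤ ENNReal.ofReal (3 * δ l / B * (1 / ρ)) * ((K + 1 : ℕ) : ENNReal) *
        volume (EB δ B ((l, q) :: st)) := by gcongr
    _ = ENNReal.ofReal (3 * δ l / B * (1 / ρ)) * (((K + 1 : ℕ) : ENNReal) *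
        volume (EB δ B ((l, q) :: st))) := by ring
    _ ≤ _ := by gcongr

def Gen {A : Type} (ok : List (ℕ × A) → ℕ → A → Prop) (W : ℕ → ℕ → ENNReal)
    (φ : List (ℕ × A) → ENNReal) : ℕ → List (ℕ × A) → ENNReal
  | 0, st => φ st
  | n + 1, st => ∑' l : ℕ, ∑' q : A,
      (if ok st l q then W st.length l else 0) * Gen ok W φ n ((l, q) :: st)

def stk {A : Type} (p : ℕ → ℕ × A) : ℕ → List (ℕ × A)
  | 0 => []
  | n + 1 => p n :: stk p n

lemma stk_length {A : Type} (p : ℕ → ℕ × A) (n : ℕ) : (stk p n).length = n := by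
  induction n with
  | zero => rfl
  | succ n ih => simp [stk, ih]

lemma mem_stk {A : Type} (p : ℕ → ℕ × A) (n : ℕ) (x : ℕ × A) :
    x ∈ stk p n ↔ ∃ i < n, x = p i := by
  induction n with
  | zero => simp [stk]
  | succ n ih =>
    simp only [stk, List.mem_cons, ih]
    constructor
    · rintro (h | ⟨i, hi, h⟩)
      · exact ⟨n, by omega, h⟩
      · exact ⟨i, by omega, h⟩
    · rintro ⟨i, hi, h⟩
      rcases Nat.lt_succ_iff_lt_or_eq.1 hi with h1 | h1
      · exact Or.inr ⟨i, h1, h⟩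
      · subst h1; exact Or.inl h

lemma Gen_path {A : Type} (ok : List (ℕ × A) → ℕ → A → Prop) (W : ℕ → ℕ → ENNReal)
    (φ : List (ℕ × A) → ENNReal) (p : ℕ → ℕ × A) (k : ℕ) : ∀ m,
    (∀ i < m + k, ok (stk p i) (p i).1 (p i).2) →
    (∏ i ∈ Finset.range k, W (m + i) (p (m + i)).1) * φ (stk p (m + k)) ≤
      Gen ok W φ k (stk p m) := by
  induction k with
  | zero => intro m _; simp [Gen]
  | succ k ih =>
    intro m h
    have h1 := ih (m + 1) (fun i hi => h i (by omega))
    have h2 := h m (by omega)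
    rw [Finset.prod_range_succ']
    simp only [Gen]
    refine le_trans ?_ (ENNReal.le_tsum (p m).1)
    refine le_trans ?_ (ENNReal.le_tsum (p m).2)
    rw [if_pos h2, stk_length]
    have h3 : ((p m).1, (p m).2) :: stk p m = stk p (m + 1) := rfl
    rw [h3]
    calc _ = W m (p m).1 * ((∏ i ∈ Finset.range k, W (m + 1 + i) (p (m + 1 + i)).1) *
          φ (stk p (m + 1 + k))) := by
          rw [show m + (k + 1) = m + 1 + k by ring, add_zero]
          have : ∏ i ∈ Finset.range k, W (m + (i + 1)) (p (m + (i + 1))).1 =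
              ∏ i ∈ Finset.range k, W (m + 1 + i) (p (m + 1 + i)).1 :=
            Finset.prod_congr rfl fun i _ => by rw [show m + (i + 1) = m + 1 + i by ring]
          rw [this]
          ring
      _ ≤ _ := by gcongr

lemma Gen_meas {A Ω : Type} [Countable A] [MeasurableSpace Ω]
    (ok : List (ℕ × A) → ℕ → A → Prop) (W : ℕ → ℕ → ENNReal)
    (φ : List (ℕ × A) → Ω → ENNReal) (hφ : ∀ st, Measurable (φ st)) (n : ℕ) : ∀ st,
    Measurable (fun y => Gen ok W (fun st => φ st y) n st) := by
  induction n with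
  | zero => intro st; exact hφ st
  | succ n ih =>
    intro st
    simp only [Gen]
    refine Measurable.tsum fun l => Measurable.tsum fun q => ?_
    exact (ih _).const_mul _

lemma Gen_lintegral {A Ω : Type} [Countable A] [MeasurableSpace Ω] (μ : Measure Ω)
    (ok : List (ℕ × A) → ℕ → A → Prop) (W : ℕ → ℕ → ENNReal)
    (φ : List (ℕ × A) → Ω → ENNReal) (hφ : ∀ st, Measurable (φ st)) (n : ℕ) : ∀ st,
    ∫⁻ y, Gen ok W (fun st => φ st y) n st ∂μ = Gen ok W (fun st => ∫⁻ y, φ st y ∂μ) n st := by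
  induction n with
  | zero => intro st; rfl
  | succ n ih =>
    intro st
    simp only [Gen]
    rw [lintegral_tsum (fun l => (Measurable.tsum fun q =>
      (Gen_meas ok W φ hφ n _).const_mul _).aemeasurable)]
    congr 1; ext l
    rw [lintegral_tsum (fun q => ((Gen_meas ok W φ hφ n _).const_mul _).aemeasurable)]
    congr 1; ext q
    rw [lintegral_const_mul _ (Gen_meas ok W φ hφ n _), ih]

lemma Gen_mono {A : Type} (ok : List (ℕ × A) → ℕ → A → Prop) (W : ℕ → ℕ → ENNReal)
    (φ φ' : List (ℕ × A) → ENNReal) (h : ∀ st, φ st ≤ φ' st) (n : ℕ) : ∀ st,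
    Gen ok W φ n st ≤ Gen ok W φ' n st := by
  induction n with
  | zero => intro st; exact h st
  | succ n ih =>
    intro st
    simp only [Gen]
    gcongr
    exact ih _

def okP {d : ℕ} (S : ℕ → (Fin d → ℤ) → Prop) (X : ℕ → ℝ) (st : List (ℕ × (Fin d → ℤ))) (l : ℕ)
    (q : Fin d → ℤ) : Prop :=
  S l q ∧ ‖iv q‖ ≤ X l ∧ (∀ p ∈ st, ‖iv p.2‖ ≤ X l) ∧ iv q ∉ WW (stQ st)

lemma stQ_card {d : ℕ} (st : List (ℕ × (Fin d → ℤ))) : (stQ st).card ≤ st.length := by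
  unfold stQ
  refine (List.toFinset_card_le _).trans ?_
  simp

lemma Gen_bound (d : ℕ) (hd : 2 ≤ d) : ∃ C : ℝ, 0 < C ∧ ∀ e : ℕ, (e = 1 ∨ (e = 2 ∧ d = 2)) →
    ∀ (S : ℕ → (Fin d → ℤ) → Prop) (X Z δ β : ℕ → ℝ) (K B : ℝ) (W : ℕ → ℕ → ENNReal),
    1 ≤ B → 0 ≤ K → (∀ l, 0 ≤ X l) → (∀ l, 1 ≤ Z l) → (∀ l, 0 < δ l) → 
    (∀ l q, S l q → q ≠ 0 → Z l ≤ ‖iv q‖) →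
    (∀ l q q', S l q → S l q' → q ≠ q' → Z l ≤ dist (iv q) (iv q')) →
    (∀ l, δ l * X l ^ (d - 1) / Z l ^ e ≤ K * β l) →
    ∀ n st, st.length + n ≤ d - 1 →
    Gen (okP S X) W (fun st => volume (EB δ B st)) n st ≤
      (∏ i ∈ Finset.range n, (ENNReal.ofReal (C * K) *
        ∑' l, W (st.length + i) l * ENNReal.ofReal (β l))) * volume (EB δ (2 ^ n * B) st) := by
  obtain ⟨C, hC, hstep⟩ := step_sum d hd
  refine ⟨3 * C, by positivity, ?_⟩
  intro e he S X Z δ β K B W hB hK hX hZ hδ hS1 hS2 hδX n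
  induction n with
  | zero => intro st _; simp [Gen]
  | succ n ih =>
    intro st hst
    set V := volume (EB δ (2 * (2 ^ n * B)) st) with hV
    set P := ∏ i ∈ Finset.range n, (ENNReal.ofReal (3 * C * K) *
        ∑' l, W (st.length + 1 + i) l * ENNReal.ofReal (β l)) with hP
    have hB' : (1 : ℝ) ≤ 2 ^ n * B := by
      have : (1 : ℝ) ≤ 2 ^ n := one_le_pow₀ (by norm_num)
      nlinarith
    have hq : ∀ l, ∑' q, (if okP S X st l q then W st.length l else 0) *
        Gen (okP S X) W (fun st => volume (EB δ B st)) n ((l, q) :: st) ≤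
        W st.length l * (ENNReal.ofReal (3 * C * K) * ENNReal.ofReal (β l)) * (P * V) := by
      intro l
      rw [ENNReal.tsum_eq_iSup_sum]
      refine iSup_le fun T => ?_
      set T' := T.filter (fun q => okP S X st l q) with hT'
      have hok : ∀ q ∈ T', okP S X st l q := fun q hq => (Finset.mem_filter.1 hq).2
      have hsum : ∑ q ∈ T', 1 / rho (WW (stQ st)) q ≤ C * (X l ^ (d - 1) / Z l ^ e) := by
        rcases T'.eq_empty_or_nonempty with hem | ⟨q0, hq0⟩
        · rw [hem, Finset.sum_empty]
          have h1 := hX l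
          have h2 := hZ l
          positivity
        refine hstep e he (stQ st) (X l) (Z l) (hX l) (hZ l)
          ((stQ_card st).trans (by omega)) ?_ T' (fun q hq => (hok q hq).2.1)
          (fun q hq => (hok q hq).2.2.2) ?_
          (fun x hx y hy hxy => hS2 l x y (hok x hx).1 (hok y hy).1 hxy)
        · intro q hq
          simp only [stQ, List.mem_toFinset, List.mem_map] at hq
          obtain ⟨p, hp, rfl⟩ := hq
          exact (hok q0 hq0).2.2.1 p hp
        · intro q hq
          refine hS1 l q (hok q hq).1 ?_
          rintro rfl
          apply (hok _ hq).2.2.2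
          have : iv (0 : Fin d → ℤ) = 0 := by ext i; simp [iv]
          rw [this]; exact zero_mem _
      calc ∑ q ∈ T, (if okP S X st l q then W st.length l else 0) *
            Gen (okP S X) W (fun st => volume (EB δ B st)) n ((l, q) :: st)
          = ∑ q ∈ T', W st.length l *
            Gen (okP S X) W (fun st => volume (EB δ B st)) n ((l, q) :: st) := by
            rw [hT', Finset.sum_filter]
            refine Finset.sum_congr rfl fun q _ => ?_
            split_ifs <;> simp
        _ ≤ ∑ q ∈ T', W st.length l * (P * (ENNReal.ofReal (3 * δ l * (1 / rho (WW (stQ st)) q)) * V)) := by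
            refine Finset.sum_le_sum fun q hq => ?_
            gcongr
            refine (ih ((l, q) :: st) (by simp only [List.length_cons]; omega)).trans ?_
            simp only [List.length_cons]
            rw [← hP]
            gcongr
            refine (EB_step δ hδ (2 ^ n * B) (by linarith) st l q (hok q hq).2.2.2).trans ?_
            rw [← hV]
            gcongr
            apply div_le_self _ hB'
            have := hδ l
            positivity
        _ = W st.length l * P * V * ENNReal.ofReal (∑ q ∈ T', 3 * δ l * (1 / rho (WW (stQ st)) q)) := by
            rw [ENNReal.ofReal_sum_of_nonneg (by
              intro q _
              have := hδ l
              positivity), Finset.mul_sum]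
            refine Finset.sum_congr rfl fun q _ => by ring
        _ ≤ W st.length l * P * V * ENNReal.ofReal ((3 * C * K) * β l) := by
            gcongr
            rw [← Finset.mul_sum]
            have := hδ l
            calc 3 * δ l * ∑ q ∈ T', 1 / rho (WW (stQ st)) q ≤
                  3 * δ l * (C * (X l ^ (d - 1) / Z l ^ e)) := by gcongr
              _ = 3 * C * (δ l * X l ^ (d - 1) / Z l ^ e) := by ring
              _ ≤ 3 * C * (K * β l) := by gcongr; exact hδX l
              _ = _ := by ring
        _ = _ := by
            rw [ENNReal.ofReal_mul (by positivity)]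
            ring
    simp only [Gen]
    calc _ ≤ ∑' l, W st.length l * (ENNReal.ofReal (3 * C * K) * ENNReal.ofReal (β l)) * (P * V) :=
          ENNReal.tsum_le_tsum hq
      _ = (ENNReal.ofReal (3 * C * K) * ∑' l, W st.length l * ENNReal.ofReal (β l)) * (P * V) := by
          rw [ENNReal.tsum_mul_right, ← ENNReal.tsum_mul_left]
          congr 2
          ext l
          ring
      _ = _ := by
          rw [Finset.prod_range_succ', hP, hV, show (2 : ℝ) * (2 ^ n * B) = 2 ^ (n + 1) * B by ring]
          have : ∏ i ∈ Finset.range n, (ENNReal.ofReal (3 * C * K) *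
                ∑' l, W (st.length + (i + 1)) l * ENNReal.ofReal (β l)) =
              ∏ i ∈ Finset.range n, (ENNReal.ofReal (3 * C * K) *
                ∑' l, W (st.length + 1 + i) l * ENNReal.ofReal (β l)) :=
            Finset.prod_congr rfl fun i _ => by
              rw [show st.length + (i + 1) = st.length + 1 + i by ring]
          rw [this, add_zero]
          ring

def cv (d : ℕ) (y : Fin (d - 1) → ℝ) : Fin d → ℝ := fun j =>
  if h : 1 ≤ (j : ℕ) then - y ⟨(j : ℕ) - 1, by have := j.isLt; omega⟩ else 1

def zv {d : ℕ} (M0 : Matrix (Fin d) (Fin d) ℝ) (y : Fin (d - 1) → ℝ) : EE d :=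
  WithLp.toLp 2 (Matrix.vecMul (cv d y) M0⁻¹)

lemma cv_cont (d : ℕ) : Continuous (cv d) := by
  apply continuous_pi
  intro j
  unfold cv
  by_cases h : 1 ≤ (j : ℕ)
  · simp only [h, dif_pos]; fun_prop
  · simp only [h]; exact continuous_const

lemma zv_cont {d : ℕ} (M0 : Matrix (Fin d) (Fin d) ℝ) : Continuous (zv M0) := by
  unfold zv
  have h1 : Continuous (fun y => Matrix.vecMul (cv d y) M0⁻¹) :=
    Continuous.matrix_vecMul (cv_cont d) continuous_const
  exact (PiLp.continuous_toLp 2 _).comp h1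

lemma EB_smul {d : ℕ} (δ : ℕ → ℝ) (B : ℝ) (st : List (ℕ × (Fin d → ℤ))) (z : EE d)
    (hz : z ∈ EB δ B st) (h : ℝ) (h1 : 1 ≤ h) (h2 : h ≤ 2) :
    h • z ∈ EB (fun l => 2 * δ l) (2 * B) st := by
  constructor
  · rw [norm_smul, Real.norm_of_nonneg (by linarith)]
    have := hz.1
    have := norm_nonneg z
    nlinarith
  · intro p hp
    rw [inner_smul_right, abs_mul, abs_of_nonneg (by linarith : (0:ℝ) ≤ h)]
    have := hz.2 p hp
    have h3 := abs_nonneg (inner ℝ (iv p.2) z)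
    nlinarith

lemma Tmap_mp {n : ℕ} (A : Matrix (Fin (n + 1)) (Fin (n + 1)) ℝ) (hA : A.det = 1) :
    MeasurePreserving (fun x : ℝ × (Fin n → ℝ) =>
      (WithLp.toLp 2 (Matrix.vecMul (Fin.cons x.1 x.2 : Fin (n + 1) → ℝ) A) : EE (n + 1)))
      volume volume := by
  have h1 := (volume_preserving_piFinSuccAbove (fun _ : Fin (n + 1) => ℝ) 0).symm
  have h2 : MeasurePreserving (Matrix.toLin' Aᵀ) (volume : Measure (Fin (n + 1) → ℝ)) volume := by
    refine ⟨(LinearMap.continuous_of_finiteDimensional _).measurable, ?_⟩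
    rw [Real.map_matrix_volume_pi_eq_smul_volume_pi (by rw [det_transpose, hA]; norm_num)]
    rw [det_transpose, hA]; simp
  have h3 := PiLp.volume_preserving_toLp (Fin (n + 1))
  have h4 := h3.comp (h2.comp h1)
  suffices h5 : (fun x : ℝ × (Fin n → ℝ) =>
      (WithLp.toLp 2 (Matrix.vecMul (Fin.cons x.1 x.2 : Fin (n + 1) → ℝ) A) : EE (n + 1))) =
      WithLp.toLp 2 ∘ ⇑(toLin' Aᵀ) ∘ ⇑(MeasurableEquiv.piFinSuccAbove (fun x => ℝ) 0).symm by
    rw [h5]; exact h4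
  funext x
  simp only [Function.comp]
  congr 1
  rw [Matrix.toLin'_apply, Matrix.mulVec_transpose]
  congr 1
  funext j
  refine Fin.cases ?_ (fun i => ?_) j
  · simp [MeasurableEquiv.piFinSuccAbove, Fin.insertNthEquiv]
  · simp [MeasurableEquiv.piFinSuccAbove, Fin.insertNthEquiv]

open scoped Pointwise in
lemma Y_vol {d : ℕ} (hd : 2 ≤ d) (M0 : Matrix (Fin d) (Fin d) ℝ) (hM0 : M0.det = 1)
    (δ : ℕ → ℝ) (B : ℝ) (st : List (ℕ × (Fin d → ℤ))) :
    volume (zv M0 ⁻¹' EB δ B st) ≤ volume (EB (fun l => 2 * δ l) (2 * B) st) := by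
  obtain ⟨n, rfl⟩ : ∃ n, d = n + 1 := ⟨d - 1, by omega⟩
  set E := EB (fun l => 2 * δ l) (2 * B) st with hE
  have hdet : (M0⁻¹).det = 1 := by rw [Matrix.det_nonsing_inv, hM0]; simp
  have hmp := Tmap_mp M0⁻¹ hdet
  have hEm : MeasurableSet E := (EB_closed _ _ _).measurableSet
  have hYm : MeasurableSet (zv M0 ⁻¹' EB δ B st) :=
    (EB_closed _ _ _).measurableSet.preimage (zv_cont M0).measurable
  rw [← hmp.measure_preimage hEm.nullMeasurableSet]
  have hTm := hEm.preimage hmp.measurable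
  rw [show (volume : Measure (ℝ × (Fin n → ℝ))) = (volume : Measure ℝ).prod volume from rfl,
    Measure.prod_apply hTm]
  set Y : Set (Fin n → ℝ) := zv M0 ⁻¹' EB δ B st with hY
  calc volume Y = ∫⁻ h in Set.Icc (1 : ℝ) 2, volume Y := by
        rw [setLIntegral_const, Real.volume_Icc]; norm_num
    _ ≤ ∫⁻ h in Set.Icc (1 : ℝ) 2, volume (Prod.mk h ⁻¹' ((fun x : ℝ × (Fin n → ℝ) =>
      (WithLp.toLp 2 (Matrix.vecMul (Fin.cons x.1 x.2 : Fin (n + 1) → ℝ) M0⁻¹) : EE (n + 1))) ⁻¹' E)) := by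
        refine setLIntegral_mono' measurableSet_Icc ?_
        intro h hh
        have h1 : (-h) • Y ⊆ Prod.mk h ⁻¹' ((fun x : ℝ × (Fin n → ℝ) =>
          (WithLp.toLp 2 (Matrix.vecMul (Fin.cons x.1 x.2 : Fin (n + 1) → ℝ) M0⁻¹) : EE (n + 1))) ⁻¹' E) := by
          rintro _ ⟨y, hy, rfl⟩
          have h2 := EB_smul δ B st (zv M0 y) hy h hh.1 hh.2
          show WithLp.toLp 2 (Matrix.vecMul (Fin.cons h ((-h) • y) : Fin (n + 1) → ℝ) M0⁻¹) ∈ E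
          convert h2 using 1
          unfold zv
          rw [← WithLp.toLp_smul, ← Matrix.smul_vecMul]
          congr 2
          funext j
          refine Fin.cases ?_ (fun i => ?_) j
          · simp [cv]
          · simp [cv]
        refine le_trans ?_ (measure_mono h1)
        rw [Measure.addHaar_smul]
        have h5 : (1 : ENNReal) ≤ ENNReal.ofReal |(-h) ^ Module.finrank ℝ (Fin n → ℝ)| := by
          rw [ENNReal.one_le_ofReal, abs_pow, abs_neg]
          exact one_le_pow₀ (hh.1.trans (le_abs_self _))
        calc volume Y = 1 * volume Y := (one_mul _).symm
          _ ≤ _ := by gcongr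
    _ ≤ _ := setLIntegral_le_lintegral _ _

lemma kap_bounds : 1 ≤ 2 / Real.sqrt 3 ∧ 2 / Real.sqrt 3 ≤ 2 := by
  have h3 : 0 < Real.sqrt 3 := Real.sqrt_pos.2 (by norm_num)
  constructor
  · rw [le_div_iff₀ h3, one_mul]
    exact Real.sqrt_le_iff.2 ⟨by norm_num, by norm_num⟩
  · apply div_le_self (by norm_num)
    rw [Real.one_le_sqrt]; norm_num

lemma siegel_chain {d : ℕ} (v : Fin d → ℝ) (hv : SiegelV d v) (i j : Fin d) (hij : i ≤ j) :
    v j ≤ (2 / Real.sqrt 3) ^ d * v i := by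
  obtain ⟨hk1, _⟩ := kap_bounds
  have key : ∀ n : ℕ, ∀ j : Fin d, (j : ℕ) = i + n → v j ≤ (2 / Real.sqrt 3) ^ n * v i := by
    intro n
    induction n with
    | zero =>
      intro j hj
      have : j = i := Fin.ext (by simpa using hj)
      rw [this]; simp
    | succ n ih =>
      intro j hj
      have hlt : (i : ℕ) + n < d := by have := j.isLt; omega
      have h1 := ih ⟨i + n, hlt⟩ rfl
      have h2 := hv.2.2 ⟨i + n, hlt⟩ j (by simp only []; omega)
      calc v j ≤ _ := h2
        _ ≤ 2 / Real.sqrt 3 * ((2 / Real.sqrt 3) ^ n * v i) := by gcongr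
        _ = _ := by ring
  have h := key (j - i) j (by have : (i : ℕ) ≤ j := hij; omega)
  refine h.trans ?_
  have := (hv.1 i).le
  have h9 : (j : ℕ) - i ≤ d := by have := j.isLt; omega
  gcongr

lemma tri_bound {d : ℕ} (hd : 2 ≤ d) (u : Fin d → Fin d → ℝ)
    (hu : ∀ i j : Fin d, i < j → |u i j| ≤ 1 / 2) (g : Fin d → ℝ) (i : Fin d)
    (hg : nMat d u *ᵥ g = Pi.single i 1) (j : Fin d) :
    (i < j → g j = 0) ∧ |g j| ≤ (d : ℝ) ^ d := by
  have hrow : ∀ j : Fin d, g j + ∑ m ∈ Finset.univ.erase j, (if j < m then u j m else 0) * g m =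
      (Pi.single i 1 : Fin d → ℝ) j := by
    intro j
    rw [← hg, Matrix.mulVec, dotProduct, ← Finset.add_sum_erase _ _ (Finset.mem_univ j)]
    congr 1
    · simp [nMat]
    · refine Finset.sum_congr rfl fun m hm => ?_
      have : j ≠ m := (Finset.ne_of_mem_erase hm).symm
      simp [nMat, this]
  have hd1 : (1 : ℝ) ≤ d := by exact_mod_cast (by omega : 1 ≤ d)
  have hd2 : (2 : ℝ) ≤ d := by exact_mod_cast hd
  have key : ∀ n : ℕ, ∀ j : Fin d, d - (j : ℕ) = n → (i < j → g j = 0) ∧ |g j| ≤ (d : ℝ) ^ n := by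
    intro n
    induction n using Nat.strong_induction_on with
    | _ n ih =>
      intro j hj
      have hjd := j.isLt
      have hr := hrow j
      constructor
      · intro hij
        rw [Finset.sum_eq_zero, add_zero] at hr
        · rw [hr, Pi.single_apply, if_neg hij.ne']
        · intro m hm
          by_cases hjm : j < m
          · have hjm' : (j : ℕ) < m := hjm
            have := m.isLt
            rw [(ih (d - m) (by omega) m rfl).1 (hij.trans hjm), mul_zero]
          · rw [if_neg hjm, zero_mul]
      · obtain ⟨n', rfl⟩ : ∃ n', n = n' + 1 := ⟨n - 1, by omega⟩
        have hb : |∑ m ∈ Finset.univ.erase j, (if j < m then u j m else 0) * g m| ≤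
            d * (1 / 2 * (d : ℝ) ^ n') := by
          refine (Finset.abs_sum_le_sum_abs _ _).trans ?_
          refine (Finset.sum_le_card_nsmul _ _ (1 / 2 * (d : ℝ) ^ n') ?_).trans ?_
          · intro m hm
            rw [abs_mul]
            by_cases hjm : j < m
            · rw [if_pos hjm]
              have hjm' : (j : ℕ) < m := hjm
              have := m.isLt
              have h1 := (ih (d - m) (by omega) m rfl).2
              have h2 : (d : ℝ) ^ (d - m) ≤ (d : ℝ) ^ n' := pow_le_pow_right₀ hd1 (by omega)
              have h3 := hu j m hjm
              gcongr
              exact h1.trans h2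
            · rw [if_neg hjm, abs_zero, zero_mul]; positivity
          · rw [nsmul_eq_mul]
            gcongr
            calc (Finset.univ.erase j).card ≤ (Finset.univ : Finset (Fin d)).card :=
                  Finset.card_le_card (Finset.erase_subset _ _)
              _ = d := by simp
        have h1 : |(Pi.single i 1 : Fin d → ℝ) j| ≤ 1 := by
          rw [Pi.single_apply]; split_ifs <;> simp
        have h2 : (1 : ℝ) ≤ d ^ n' := one_le_pow₀ hd1
        have h3 : g j = (Pi.single i 1 : Fin d → ℝ) j -
          ∑ m ∈ Finset.univ.erase j, (if j < m then u j m else 0) * g m := by linarith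
        rw [h3]
        refine (abs_sub _ _).trans ?_
        rw [pow_succ]
        nlinarith
  have := key (d - j) j rfl
  refine ⟨this.1, this.2.trans ?_⟩
  exact pow_le_pow_right₀ hd1 (by omega)

lemma orth_entry {d : ℕ} (k : Matrix (Fin d) (Fin d) ℝ) (hk : k * kᵀ = 1) (i j : Fin d) :
    |k i j| ≤ 1 := by
  have h := congrFun (congrFun hk i) i
  rw [Matrix.mul_apply, Matrix.one_apply_eq] at h
  simp only [Matrix.transpose_apply] at h
  have h2 : k i j * k i j ≤ 1 := by
    rw [← h]
    exact Finset.single_le_sum (f := fun m => k i m * k i m) (fun m _ => mul_self_nonneg _)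
      (Finset.mem_univ j)
  rw [abs_le_one_iff_mul_self_le_one]
  exact h2

lemma c_bound {d : ℕ} (hd : 2 ≤ d) (u : Fin d → Fin d → ℝ)
    (hu : ∀ i j : Fin d, i < j → |u i j| ≤ 1 / 2) (v : Fin d → ℝ) (hv : SiegelV d v)
    (k : Matrix (Fin d) (Fin d) ℝ) (hk : k * kᵀ = 1) (c : Fin d → ℝ) (i : Fin d)
    (hc : (nMat d u * Matrix.diagonal v * k) *ᵥ c = Pi.single i 1) (j : Fin d) :
    |c j| ≤ d * (d ^ d * 2 ^ d) / v i := by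
  set w := k *ᵥ c with hw
  set g := Matrix.diagonal v *ᵥ w with hg
  have h1 : nMat d u *ᵥ g = Pi.single i 1 := by
    rw [hg, hw, Matrix.mulVec_mulVec, Matrix.mulVec_mulVec]; exact hc
  have hwj : ∀ m, |w m| ≤ d ^ d * 2 ^ d / v i := by
    intro m
    have h2 := tri_bound hd u hu g i h1 m
    have h3 : g m = v m * w m := by rw [hg, Matrix.mulVec_diagonal]
    have hvm := hv.1 m
    have hvi := hv.1 i
    by_cases him : i < m
    · have h4 := h2.1 him
      rw [h3] at h4
      have : w m = 0 := by
        rcases mul_eq_zero.1 h4 with h | h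
        · linarith
        · exact h
      rw [this, abs_zero]; positivity
    · have h5 := siegel_chain v hv m i (not_lt.1 him)
      have h6 : (2 / Real.sqrt 3) ^ d ≤ 2 ^ d := by
        have := kap_bounds
        have h7 : 0 ≤ 2 / Real.sqrt 3 := by linarith [this.1]
        exact pow_le_pow_left₀ h7 this.2 d
      have h8 : v i ≤ 2 ^ d * v m := h5.trans (by gcongr)
      have h9 := h2.2
      rw [h3, abs_mul, abs_of_pos hvm] at h9
      rw [le_div_iff₀ hvi]
      calc |w m| * v i ≤ |w m| * (2 ^ d * v m) := by gcongr
        _ = (v m * |w m|) * 2 ^ d := by ring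
        _ ≤ _ := by gcongr
  have hk' : kᵀ * k = 1 := mul_eq_one_comm.1 hk
  have hcw : c = kᵀ *ᵥ w := by rw [hw, Matrix.mulVec_mulVec, hk', Matrix.one_mulVec]
  have hcj : c j = ∑ m, k m j * w m := by rw [hcw]; simp [Matrix.mulVec, dotProduct]
  rw [hcj]
  refine (Finset.abs_sum_le_sum_abs _ _).trans ?_
  refine (Finset.sum_le_card_nsmul _ _ (d ^ d * 2 ^ d / v i) ?_).trans ?_
  · intro m _
    rw [abs_mul]
    have := orth_entry k hk m j
    calc |k m j| * |w m| ≤ 1 * |w m| := by gcongr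
      _ ≤ _ := by rw [one_mul]; exact hwj m
  · rw [nsmul_eq_mul]; simp [mul_div_assoc]

lemma prod_filter_lt {d : ℕ} (s : ℕ) (hs : s ≤ d) (f : Fin d → ℝ) (f' : ℕ → ℝ)
    (h : ∀ i : Fin d, (i : ℕ) < s → f i = f' i) :
    ∏ i ∈ Finset.univ.filter (fun i : Fin d => (i : ℕ) < s), f i = ∏ i ∈ Finset.range s, f' i := by
  refine Finset.prod_bij (fun i _ => (i : ℕ)) ?_ ?_ ?_ ?_
  · intro i hi; simpa using hi
  · intro i _ j _ hij; exact Fin.ext hij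
  · intro b hb
    have hb' : b < s := by simpa using hb
    exact ⟨⟨b, by omega⟩, by simpa using hb', rfl⟩
  · intro i hi
    exact h i (by simpa using hi)

lemma sVal_le {d : ℕ} (r : ℝ) (v : Fin d → ℝ) : sVal d r v ≤ d - 1 := by
  unfold sVal
  apply csSup_le'
  intro s hs
  exact hs.2.1

lemma sVal_mem {d : ℕ} (r : ℝ) (v : Fin d → ℝ) (h : sVal d r v ≠ 0) :
    ∃ i : Fin d, (i : ℕ) + 1 = sVal d r v ∧ 2 * cd' d * r < v i := by
  set Sset := {s : ℕ | 1 ≤ s ∧ s ≤ d - 1 ∧ ∃ i : Fin d, (i : ℕ) + 1 = s ∧ 2 * cd' d * r < v i} with hS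
  have hne : Sset.Nonempty := by
    by_contra hem
    rw [Set.not_nonempty_iff_eq_empty] at hem
    apply h
    unfold sVal
    rw [← hS, hem]; simp
  have hm : sSup Sset ∈ Sset := Nat.sSup_mem hne ⟨d - 1, fun s hs => hs.2.1⟩
  exact hm.2.2

lemma v_low {d : ℕ} (r : ℝ) (v : Fin d → ℝ) (hv : SiegelV d v) (i : Fin d)
    (hi : (i : ℕ) < sVal d r v) : 2 * d * r ≤ v i := by
  obtain ⟨j, hj, hjv⟩ := sVal_mem r v (by omega)
  have h1 := siegel_chain v hv i j (by rw [Fin.le_def]; omega)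
  have h2 : 0 < (2 / Real.sqrt 3) ^ d := by
    have := kap_bounds.1
    have : 0 < 2 / Real.sqrt 3 := by linarith
    positivity
  unfold cd' at hjv
  have h3 : (2 / Real.sqrt 3) ^ d * (2 * d * r) ≤ (2 / Real.sqrt 3) ^ d * v i := by
    refine le_trans ?_ h1
    nlinarith
  exact le_of_mul_le_mul_left h3 h2

lemma mulVec_bound {d : ℕ} (A : Matrix (Fin d) (Fin d) ℝ) (x : Fin d → ℝ) (a b : ℝ)
    (ha : ∀ i j, |A i j| ≤ a) (hb : ∀ j, |x j| ≤ b) (i : Fin d) : |(A *ᵥ x) i| ≤ d * (a * b) := by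
  rw [Matrix.mulVec, dotProduct]
  refine (Finset.abs_sum_le_sum_abs _ _).trans ?_
  refine (Finset.sum_le_card_nsmul _ _ (a * b) ?_).trans ?_
  · intro m _
    rw [abs_mul]
    have h1 := ha i m
    have h2 := hb m
    have h3 := (abs_nonneg _).trans h1
    gcongr
  · rw [nsmul_eq_mul]; simp

lemma iv_norm_le {d : ℕ} (q : Fin d → ℤ) (b : ℝ) (hb : ∀ j, |(q j : ℝ)| ≤ b) (hb0 : 0 ≤ b) :
    ‖iv q‖ ≤ d * b := by
  rw [EuclideanSpace.norm_eq]
  apply Real.sqrt_le_iff.2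
  refine ⟨by positivity, ?_⟩
  refine (Finset.sum_le_card_nsmul _ _ (b ^ 2) ?_).trans ?_
  · intro m _
    have := hb m
    simp only [iv, Real.norm_eq_abs]
    gcongr
  · rw [nsmul_eq_mul]
    simp only [Finset.card_univ, Fintype.card_fin]
    have : (d : ℝ) ≤ (d : ℝ) ^ 2 := by
      have : d ≤ d ^ 2 := by nlinarith [Nat.zero_le d, Nat.lt_or_ge 0 d]
      exact_mod_cast this
    rw [mul_pow]
    gcongr

lemma det_nt {d : ℕ} (y : Fin (d - 1) → ℝ) : (ntilde d y).det = 1 := by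
  rw [Matrix.det_of_isUpperTriangular]
  · simp [ntilde]
  · intro i j hij
    have hij' : j < i := hij
    have h1 : i ≠ j := hij'.ne'
    have h2 : ¬ ((i : ℕ) = 0 ∧ 1 ≤ (j : ℕ)) := by
      have : (j : ℕ) < i := hij'
      omega
    simp [ntilde, h1]
    intro h3
    have : (j : ℕ) < i := hij'
    rw [h3] at this
    simp at this

lemma det_Phi {d : ℕ} (hd : 2 ≤ d) (t : ℝ) : (Phi d t).det = 1 := by
  obtain ⟨n, rfl⟩ : ∃ n, d = n + 1 := ⟨d - 1, by omega⟩
  unfold Phi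
  rw [Matrix.det_diagonal, Fin.prod_univ_succ]
  simp only [Fin.val_zero, if_true, Fin.val_succ, Nat.add_eq_zero_iff, one_ne_zero, and_false, if_false]
  rw [Finset.prod_const, ← Real.exp_nat_mul, ← Real.exp_add, Real.exp_eq_one_iff]
  simp only [Finset.card_univ, Fintype.card_fin]
  push_cast
  field_simp
  ring

lemma det_gM {d : ℕ} (hd : 2 ≤ d) (M0 : Matrix (Fin d) (Fin d) ℝ) (hM0 : M0.det = 1)
    (y : Fin (d - 1) → ℝ) (t : ℝ) : (M0 * ntilde d y * Phi d t).det = 1 := by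
  rw [Matrix.det_mul, Matrix.det_mul, hM0, det_nt, det_Phi hd]; norm_num

lemma cv_nt {d : ℕ} (hd : 2 ≤ d) (y : Fin (d - 1) → ℝ) :
    cv d y ᵥ* ntilde d y = Pi.single ⟨0, by omega⟩ 1 := by
  obtain ⟨n, rfl⟩ : ∃ n, d = n + 1 := ⟨d - 1, by omega⟩
  funext j
  rw [Matrix.vecMul, dotProduct, Fin.sum_univ_succ]
  refine Fin.cases ?_ (fun i => ?_) j
  · simp [cv, ntilde]
  · rw [Finset.sum_eq_single i]
    · simp [cv, ntilde, (Fin.succ_ne_zero i).symm]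
    · intro b _ hb
      simp [ntilde, hb]
    · simp

lemma inner_zv {d : ℕ} (hd : 2 ≤ d) (M0 : Matrix (Fin d) (Fin d) ℝ) (hM0 : M0.det = 1)
    (y : Fin (d - 1) → ℝ) (t : ℝ) (q : Fin d → ℤ) (c : Fin d → ℝ)
    (hc : (M0 * ntilde d y * Phi d t) *ᵥ c = fun i => (q i : ℝ)) :
    inner ℝ (iv q) (zv M0 y) = Real.exp (-((d : ℝ) - 1) * t / d) * c ⟨0, by omega⟩ := by
  have h1 : inner ℝ (iv q) (zv M0 y) = (cv d y ᵥ* M0⁻¹) ⬝ᵥ (fun i => (q i : ℝ)) := by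
    simp [PiLp.inner_apply, iv, zv, dotProduct]
  rw [h1, ← Matrix.dotProduct_mulVec, ← hc, Matrix.mulVec_mulVec, mul_assoc, ← mul_assoc M0⁻¹,
    Matrix.nonsing_inv_mul _ (by rw [hM0]; exact isUnit_one), one_mul, ← Matrix.mulVec_mulVec,
    Matrix.dotProduct_mulVec, cv_nt hd]
  simp [Phi, Matrix.mulVec_diagonal]

lemma q_bound {d : ℕ} (hd : 2 ≤ d) (M0 : Matrix (Fin d) (Fin d) ℝ) (m0 Y0 : ℝ)
    (hm0 : ∀ i j, |M0 i j| ≤ m0) (hY0 : 0 ≤ Y0)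
    (y : Fin (d - 1) → ℝ) (hy : ∀ j, |y j| ≤ Y0) (t : ℝ) (ht : 0 ≤ t) (q : Fin d → ℤ) (c : Fin d → ℝ)
    (hc : (M0 * ntilde d y * Phi d t) *ᵥ c = fun i => (q i : ℝ)) (κ : ℝ) (hκ : ∀ j, |c j| ≤ κ) :
    ‖iv q‖ ≤ d * (d * (m0 * (d * ((1 + Y0) * (Real.exp (t / d) * κ))))) := by
  have hκ0 : 0 ≤ κ := (abs_nonneg _).trans (hκ ⟨0, by omega⟩)
  have hm00 : 0 ≤ m0 := (abs_nonneg _).trans (hm0 ⟨0, by omega⟩ ⟨0, by omega⟩)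
  have hd0 : (0 : ℝ) < d := by exact_mod_cast (by omega : 0 < d)
  have hd1 : (1 : ℝ) ≤ d := by exact_mod_cast (by omega : 1 ≤ d)
  apply iv_norm_le _ _ _ (by positivity)
  intro j
  have h0 := congrFun hc j
  rw [← h0, mul_assoc, ← Matrix.mulVec_mulVec]
  apply mulVec_bound _ _ _ _ hm0
  intro i
  rw [← Matrix.mulVec_mulVec]
  apply mulVec_bound
  · intro i j
    simp only [ntilde, Matrix.of_apply]
    split_ifs
    · simp; exact hY0
    · exact (hy _).trans (by linarith)
    · simp; linarith
  · intro m
    rw [Phi, Matrix.mulVec_diagonal, abs_mul]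
    have h2 : |(if (m : ℕ) = 0 then Real.exp (-((d : ℝ) - 1) * t / d) else Real.exp (t / d))| ≤
        Real.exp (t / d) := by
      split_ifs
      · rw [abs_of_pos (Real.exp_pos _)]
        apply Real.exp_le_exp.2
        gcongr
        nlinarith
      · rw [abs_of_pos (Real.exp_pos _)]
    have := hκ m
    gcongr

def Sdio {d : ℕ} (ξ : Fin d → ℝ) (l : ℕ) (q : Fin d → ℤ) : Prop :=
  distToInt (∑ i, ξ i * (q i : ℝ)) ≤ 2 ^ d / 2 ^ l / 2

def XX (d : ℕ) (A t : ℝ) (l : ℕ) : ℝ := A * Real.exp (t / d) / 2 ^ l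

def dd (d : ℕ) (A t : ℝ) (l : ℕ) : ℝ := A * Real.exp (-((d : ℝ) - 1) * t / d) / 2 ^ l

lemma siegel_qs {d : ℕ} (hd : 2 ≤ d) (ξ : Fin d → ℝ)
    (M : Matrix (Fin d) (Fin d) ℝ) (hM : M.det = 1) (v b : Fin d → ℝ) (hv : SiegelV d v)
    (u : Fin d → Fin d → ℝ) (k : Matrix (Fin d) (Fin d) ℝ)
    (hu : ∀ i j : Fin d, i < j → |u i j| ≤ 1 / 2) (hk : k * kᵀ = 1)
    (hrel : gammaRel d (M, vecMul ξ M) (nMat d u * Matrix.diagonal v * k,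
         Matrix.vecMul b (nMat d u * Matrix.diagonal v * k))) :
    ∃ (q : Fin d → Fin d → ℤ) (c : Fin d → Fin d → ℝ),
      (∀ i, M *ᵥ c i = fun j => (q i j : ℝ)) ∧
      (∀ i j, |c i j| ≤ d * (d ^ d * 2 ^ d) / v i) ∧
      (∀ i, distToInt (∑ j, ξ j * (q i j : ℝ)) ≤ |b i|) ∧
      (∀ i : Fin d, ∀ Q : Finset (Fin d → ℤ), (∀ x ∈ Q, ∃ j, j ≠ i ∧ x = q j) → iv (q i) ∉ WW Q) := by
  obtain ⟨γ, m, hγ, hN, hbN⟩ := hrel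
  simp only at hN hbN
  set γR : Matrix (Fin d) (Fin d) ℝ := γ.map fun x => (x : ℝ) with hγR
  set aR : Matrix (Fin d) (Fin d) ℝ := γ.adjugate.map fun x => (x : ℝ) with haR
  have h1 : γR * aR = 1 := by
    have h2 : γ * γ.adjugate = 1 := by rw [Matrix.mul_adjugate, hγ, one_smul]
    have h3 := congrArg (fun A : Matrix (Fin d) (Fin d) ℤ => A.map (Int.castRingHom ℝ)) h2
    simp only [Matrix.map_mul] at h3
    rw [Matrix.map_one _ (map_zero _) (map_one _)] at h3
    exact h3
  have hu1 : IsUnit M.det := by rw [hM]; exact isUnit_one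
  let q : Fin d → Fin d → ℤ := fun i j => γ.adjugate j i
  let c : Fin d → Fin d → ℝ := fun i => M⁻¹ *ᵥ (fun j => (q i j : ℝ))
  have hc : ∀ i, M *ᵥ c i = fun j => (q i j : ℝ) := by
    intro i
    simp only [c]
    rw [Matrix.mulVec_mulVec, Matrix.mul_nonsing_inv _ hu1, Matrix.one_mulVec]
  have hq1 : ∀ i, γR *ᵥ (fun j => (q i j : ℝ)) = Pi.single i 1 := by
    intro i
    funext j
    have := congrFun (congrFun h1 j) i
    rw [Matrix.mul_apply] at this
    rw [Matrix.mulVec, dotProduct]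
    simp only [q]
    refine Eq.trans this ?_
    rw [Matrix.one_apply, Pi.single_apply]
  refine ⟨q, c, hc, ?_, ?_, ?_⟩
  · intro i j
    refine c_bound hd u hu v hv k hk (c i) i ?_ j
    rw [hN, ← Matrix.mulVec_mulVec, hc, hq1]
  · intro i
    rw [hN] at hbN
    have h2 : vecMul b γR = (fun j => (m j : ℝ)) + ξ := by
      have h3 := congrArg (fun x => vecMul x M⁻¹) hbN
      rw [← Matrix.add_vecMul, Matrix.vecMul_vecMul, Matrix.vecMul_vecMul,
        Matrix.mul_assoc, Matrix.mul_nonsing_inv _ hu1, Matrix.mul_one, Matrix.vecMul_one] at h3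
      exact h3
    have h4 : b i = (∑ j, ξ j * (q i j : ℝ)) - ((-∑ j, m j * q i j : ℤ) : ℝ) := by
      have h5 : vecMul (vecMul b γR) aR = b := by
        rw [Matrix.vecMul_vecMul, h1, Matrix.vecMul_one]
      rw [h2] at h5
      rw [← h5]
      simp only [Matrix.vecMul, dotProduct, Pi.add_apply, add_mul, Finset.sum_add_distrib, haR,
        Matrix.map_apply, q]
      push_cast
      ring
    rw [h4]
    exact round_le _ _
  · intro i Q hQ hmem
    let f : EE d →ₗ[ℝ] ℝ :=
      (LinearMap.proj i) ∘ₗ (Matrix.toLin' γR) ∘ₗ (WithLp.linearEquiv 2 ℝ (Fin d → ℝ)).toLinearMap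
    have hf : ∀ x, f (iv x) = (γR *ᵥ (fun j => (x j : ℝ))) i := fun x => by
      simp [f, iv]
    have hle : WW Q ≤ LinearMap.ker f := by
      rw [WW, Submodule.span_le]
      rintro _ ⟨x, hx, rfl⟩
      obtain ⟨j, hj, rfl⟩ := hQ x hx
      rw [SetLike.mem_coe, LinearMap.mem_ker, hf, hq1, Pi.single_apply, if_neg hj.symm]
    have h6 := hle hmem
    rw [LinearMap.mem_ker, hf, hq1] at h6
    simp at h6

lemma pointwise {d : ℕ} (hd : 2 ≤ d) (ξ : Fin d → ℝ) (M0 : Matrix (Fin d) (Fin d) ℝ)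
    (hM0 : M0.det = 1) (η r : ℝ) (hη : 0 < η) (hr : 0 < r)
    (vc bc : (Matrix (Fin d) (Fin d) ℝ × (Fin d → ℝ)) → (Fin d → ℝ))
    (hsec : IsSiegelSection d vc bc) (Y0 B : ℝ) (hY0 : 0 ≤ Y0) :
    ∃ A : ℝ, 0 < A ∧ ∀ (y : Fin (d - 1) → ℝ) (t : ℝ), (∀ j, |y j| ≤ Y0) → 0 ≤ t → ‖zv M0 y‖ ≤ B →
      ∀ (L : ℕ) (R : ℝ), (max 1 (2 * d * r * 2 ^ L)) ^ d < R →
      Ffun d R η r (vc (gElt d ξ M0 y t)) (bc (gElt d ξ M0 y t)) ≠ 0 →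
      ∃ (s : ℕ) (p : ℕ → ℕ × (Fin d → ℤ)), s ≤ d - 1 ∧
        (∀ i < s, okP (Sdio ξ) (XX d A t) (stk p i) (p i).1 (p i).2) ∧
        zv M0 y ∈ EB (dd d A t) B (stk p s) ∧
        Ffun d R η r (vc (gElt d ξ M0 y t)) (bc (gElt d ξ M0 y t)) ≤
          ∏ i ∈ Finset.range s, (2 * d * r * 2 ^ ((p i).1 + 1)) ^ η ∧
        ∃ k < s, L ≤ (p k).1 := by
  have hd0 : (0 : ℝ) < d := by exact_mod_cast (by omega : 0 < d)
  obtain ⟨m0, hm00, hm0⟩ : ∃ m0 : ℝ, 1 ≤ m0 ∧ ∀ i j, |M0 i j| ≤ m0 := by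
    refine ⟨1 + ∑ i, ∑ j, |M0 i j|, ?_, ?_⟩
    · have : 0 ≤ ∑ i, ∑ j, |M0 i j| := Finset.sum_nonneg fun _ _ => Finset.sum_nonneg fun _ _ => abs_nonneg _
      linarith
    · intro i j
      have h1 : |M0 i j| ≤ ∑ j, |M0 i j| :=
        Finset.single_le_sum (f := fun j => |M0 i j|) (fun _ _ => abs_nonneg _) (Finset.mem_univ j)
      have h2 : ∑ j, |M0 i j| ≤ ∑ i, ∑ j, |M0 i j| :=
        Finset.single_le_sum (f := fun i => ∑ j, |M0 i j|)
          (fun _ _ => Finset.sum_nonneg fun _ _ => abs_nonneg _) (Finset.mem_univ i)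
      linarith
  set vm : ℝ := 2 * d * r with hvm
  have hvm0 : 0 < vm := by positivity
  set K1 : ℝ := d * (d ^ d * 2 ^ d) with hK1
  have hK10 : 0 < K1 := by positivity
  set C1 : ℝ := d * (d * (m0 * (d * ((1 + Y0) * K1)))) with hC1
  have hC10 : 0 < C1 := by positivity
  set A : ℝ := (C1 + K1) * 2 ^ d / vm with hA
  have hA0 : 0 < A := by positivity
  refine ⟨A, hA0, ?_⟩
  intro y t hy ht hzB L R hR hF
  have hsd := hsec.2.2 (gElt d ξ M0 y t) (det_gM hd M0 hM0 y t)
  set v := vc (gElt d ξ M0 y t) with hv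
  set b := bc (gElt d ξ M0 y t) with hb
  obtain ⟨hV, _, u, k, hu, hk, _, hrel⟩ := hsd
  obtain ⟨q, c, hMc, hcb, hdist, hind⟩ := siegel_qs hd ξ _ (det_gM hd M0 hM0 y t) v b hV u k hu hk hrel
  set s := sVal d r v with hs
  have hsd1 : s ≤ d - 1 := sVal_le r v
  unfold Ffun at hF
  rw [← hs] at hF
  have hF1 := left_ne_zero_of_mul hF
  have hF2 := right_ne_zero_of_mul hF
  have hRle : R ≤ ∏ i ∈ Finset.univ.filter (fun i : Fin d => (i : ℕ) < s), v i := by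
    by_contra h
    rw [if_neg h] at hF1
    exact hF1 rfl
  have hbi : ∀ i : Fin d, (i : ℕ) < s → |v i * b i| ≤ cd' d * r := by
    intro i hi
    by_contra h
    apply hF2
    apply Finset.prod_eq_zero (i := i) (by simpa using hi)
    rw [if_neg h, mul_zero]
  have hvl : ∀ i : Fin d, (i : ℕ) < s → vm ≤ v i := fun i hi => v_low r v hV i hi
  have hex : ∀ i : Fin d, ∃ l : ℕ, (i : ℕ) < s → vm * 2 ^ l ≤ v i ∧ v i < vm * 2 ^ (l + 1) := by
    intro i
    by_cases hi : (i : ℕ) < s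
    · have h1 : 1 ≤ v i / vm := by rw [le_div_iff₀ hvm0, one_mul]; exact hvl i hi
      obtain ⟨l, h2, h3⟩ := exists_nat_pow_near h1 (by norm_num : (1 : ℝ) < 2)
      refine ⟨l, fun _ => ⟨?_, ?_⟩⟩
      · rw [le_div_iff₀ hvm0] at h2; linarith
      · rw [div_lt_iff₀ hvm0] at h3; linarith
    · exact ⟨0, fun h => absurd h hi⟩
  choose l hl using hex
  let p : ℕ → ℕ × (Fin d → ℤ) := fun i => if h : i < d then (l ⟨i, h⟩, q ⟨i, h⟩) else (0, 0)
  have hp : ∀ i : Fin d, p i = (l i, q i) := by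
    intro i
    simp [p, i.isLt]
  have h2d : (2 / Real.sqrt 3) ^ d ≤ 2 ^ d := by
    have := kap_bounds
    have h7 : 0 ≤ 2 / Real.sqrt 3 := by linarith [this.1]
    exact pow_le_pow_left₀ h7 this.2 d
  have hqn : ∀ i : Fin d, ‖iv (q i)‖ ≤ C1 * Real.exp (t / d) / v i := by
    intro i
    refine (q_bound hd M0 m0 Y0 hm0 hY0 y hy t ht (q i) (c i) (hMc i) _ (hcb i)).trans (le_of_eq ?_)
    rw [hC1, hK1]; ring
  have hXb : ∀ i j : Fin d, i ≤ j → (j : ℕ) < s → ‖iv (q i)‖ ≤ XX d A t (l j) := by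
    intro i j hij hj
    refine (hqn i).trans ?_
    have h1 := siegel_chain v hV i j hij
    have hvi := hV.1 i
    have h2 : vm * 2 ^ (l j) ≤ 2 ^ d * v i :=
      (hl j hj).1.trans (h1.trans (by gcongr))
    unfold XX
    rw [div_le_div_iff₀ hvi (by positivity), hA]
    have h3 : C1 * Real.exp (t / d) * 2 ^ l j = C1 * Real.exp (t / d) / vm * (vm * 2 ^ l j) := by
      field_simp
    rw [h3]
    calc C1 * Real.exp (t / d) / vm * (vm * 2 ^ l j) ≤
          C1 * Real.exp (t / d) / vm * (2 ^ d * v i) := by gcongr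
      _ ≤ (C1 + K1) * Real.exp (t / d) / vm * (2 ^ d * v i) := by gcongr; linarith
      _ = _ := by ring
  refine ⟨s, p, hsd1, ?_, ⟨hzB, ?_⟩, ?_, ?_⟩
  · intro i his
    have hid : i < d := by omega
    have hpi := hp ⟨i, hid⟩
    simp only at hpi
    rw [hpi]
    refine ⟨?_, hXb _ _ le_rfl his, ?_, ?_⟩
    · unfold Sdio
      refine (hdist _).trans ?_
      have h1 := hbi ⟨i, hid⟩ his
      have hvi := hV.1 ⟨i, hid⟩
      have h2 := (hl ⟨i, hid⟩ his).1
      rw [abs_mul, abs_of_pos hvi] at h1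
      set ll := l ⟨i, hid⟩
      have h4 : vm * 2 ^ ll * |b ⟨i, hid⟩| ≤ d * 2 ^ d * r := by
        calc _ ≤ v ⟨i, hid⟩ * |b ⟨i, hid⟩| := by gcongr
          _ ≤ cd' d * r := h1
          _ ≤ _ := by unfold cd'; gcongr
      rw [div_div, le_div_iff₀ (by positivity)]
      have h5 : d * r * (|b ⟨i, hid⟩| * (2 ^ ll * 2)) ≤ d * r * 2 ^ d := by
        rw [hvm] at h4
        linarith
      exact le_of_mul_le_mul_left h5 (by positivity)
    · intro x hx
      rw [mem_stk] at hx
      obtain ⟨j, hj, rfl⟩ := hx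
      have hpj := hp ⟨j, by omega⟩
      simp only at hpj
      rw [hpj]
      exact hXb _ _ (by rw [Fin.le_def]; simp only []; omega) his
    · apply hind
      intro x hx
      simp only [stQ, List.mem_toFinset, List.mem_map, mem_stk] at hx
      obtain ⟨_, ⟨j, hj, rfl⟩, rfl⟩ := hx
      have hpj := hp ⟨j, by omega⟩
      simp only at hpj
      rw [hpj]
      refine ⟨⟨j, by omega⟩, ?_, rfl⟩
      intro h
      rw [Fin.mk.injEq] at h
      omega
  · intro x hx
    rw [mem_stk] at hx
    obtain ⟨j, hj, rfl⟩ := hx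
    have hjd : j < d := by omega
    have hpj := hp ⟨j, hjd⟩
    simp only at hpj
    rw [hpj]
    simp only
    rw [inner_zv hd M0 hM0 y t _ _ (hMc ⟨j, hjd⟩), abs_mul, abs_of_pos (Real.exp_pos _)]
    have h1 := hcb ⟨j, hjd⟩ ⟨0, by omega⟩
    have h2 := (hl ⟨j, hjd⟩ hj).1
    have hvi := hV.1 ⟨j, hjd⟩
    set ll := l ⟨j, hjd⟩
    unfold dd
    have h3 : |c ⟨j, hjd⟩ ⟨0, by omega⟩| ≤ A / 2 ^ ll := by
      refine h1.trans ?_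
      rw [← hK1]
      calc K1 / v ⟨j, hjd⟩ ≤ K1 / (vm * 2 ^ ll) := by gcongr
        _ = K1 / vm / 2 ^ ll := by rw [div_div]
        _ ≤ A / 2 ^ ll := by
          gcongr
          rw [hA]
          gcongr
          have : (1 : ℝ) ≤ 2 ^ d := one_le_pow₀ (by norm_num)
          nlinarith
    calc _ ≤ Real.exp (-((d : ℝ) - 1) * t / d) * (A / 2 ^ ll) := by gcongr
      _ = _ := by ring
  · unfold Ffun
    rw [← hs, if_pos hRle, one_mul]
    rw [← prod_filter_lt s (by omega) (fun i : Fin d => (vm * 2 ^ ((p i).1 + 1)) ^ η)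
      (fun i => (vm * 2 ^ ((p i).1 + 1)) ^ η) (fun i _ => rfl)]
    refine Finset.prod_le_prod (R := ℝ) ?_ ?_
    · intro i hi
      have := (hV.1 i).le
      split_ifs <;> positivity
    · intro i hi
      have hi' : (i : ℕ) < s := by simpa using hi
      rw [if_pos (hbi i hi'), mul_one, hp]
      exact Real.rpow_le_rpow (hV.1 i).le (hl i hi').2.le hη.le
  · by_contra hcon
    push Not at hcon
    have h1 : ∏ i ∈ Finset.univ.filter (fun i : Fin d => (i : ℕ) < s), v i ≤
        ∏ i ∈ Finset.univ.filter (fun i : Fin d => (i : ℕ) < s), (max 1 (vm * 2 ^ L)) := by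
      apply Finset.prod_le_prod
      · intro i _; exact (hV.1 i).le
      · intro i hi
        have hi' : (i : ℕ) < s := by simpa using hi
        have h2 := hcon i hi'
        rw [hp] at h2
        refine (hl i hi').2.le.trans (le_trans ?_ (le_max_right _ _))
        gcongr
        · norm_num
        · exact h2
    rw [Finset.prod_const] at h1
    have h3 : (max 1 (vm * 2 ^ L)) ^ (Finset.univ.filter (fun i : Fin d => (i : ℕ) < s)).card ≤
        (max 1 (vm * 2 ^ L)) ^ d := by
      apply pow_le_pow_right₀ (le_max_left _ _)
      calc _ ≤ (Finset.univ : Finset (Fin d)).card := Finset.card_filter_le _ _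
        _ = d := by simp
    linarith

lemma distToInt_sub (x y : ℝ) : distToInt (x - y) ≤ distToInt x + distToInt y := by
  unfold distToInt
  refine (round_le (x - y) (round x - round y)).trans ?_
  push_cast
  calc |x - y - (round x - round y)| = |(x - round x) - (y - round y)| := by congr 1; ring
    _ ≤ _ := abs_sub _ _

lemma zeta_le {d : ℕ} (ξ : Fin d → ℝ) (T : ℝ) (q : Fin d → ℤ) (hq : q ≠ 0)
    (h : distToInt (∑ i, ξ i * (q i : ℝ)) ≤ 1 / T) : (zetaDio ξ T : ℝ) ≤ ‖iv q‖ := by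
  have h1 : zetaDio ξ T ≤ ⌊‖iv q‖⌋₊ := by
    apply Nat.sInf_le
    refine ⟨q, hq, ?_, h⟩
    intro i
    have h2 := iv_norm_ge q i
    have h3 : (q i).natAbs ≤ ⌊‖iv q‖⌋₊ := by
      apply Nat.le_floor
      rw [Nat.cast_natAbs]
      push_cast
      exact h2
    rw [Int.abs_eq_natAbs]
    exact_mod_cast h3
  exact (Nat.cast_le.2 h1).trans (Nat.floor_le (norm_nonneg _))

lemma zeta_ge_one {d : ℕ} (hd : 2 ≤ d) (ξ : Fin d → ℝ) (n : ℕ) :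
    1 ≤ zetaDio ξ ((2 : ℝ) ^ n) := by
  set Sset := {N : ℕ | ∃ m : Fin d → ℤ, m ≠ 0 ∧ (∀ i, |m i| ≤ (N : ℤ)) ∧
    distToInt (∑ i, ξ i * (m i : ℝ)) ≤ 1 / (2 : ℝ) ^ n} with hS
  have hne : Sset.Nonempty := by
    obtain ⟨j, k, hk0, hkn, hjk⟩ := Real.exists_int_int_abs_mul_sub_le (ξ ⟨0, by omega⟩)
      (n := 2 ^ n) (by positivity)
    refine ⟨k.natAbs, Pi.single ⟨0, by omega⟩ k, ?_, ?_, ?_⟩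
    · intro h
      have := congrFun h ⟨0, by omega⟩
      simp at this
      omega
    · intro i
      rw [Pi.single_apply]
      split_ifs
      · rw [Int.abs_eq_natAbs]
      · simp
    · have h1 : ∑ i, ξ i * ((Pi.single ⟨0, by omega⟩ k : Fin d → ℤ) i : ℝ) = k * ξ ⟨0, by omega⟩ := by
        rw [Finset.sum_eq_single ⟨0, by omega⟩]
        · simp [mul_comm]
        · intro b _ hb
          simp [hb]
        · simp
      rw [h1]
      refine (round_le _ j).trans (hjk.trans ?_)
      push_cast
      apply one_div_le_one_div_of_le (by positivity)
      linarith
  have hm : sInf Sset ∈ Sset := Nat.sInf_mem hne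
  have h0 : sInf Sset ≠ 0 := by
    intro h
    rw [h] at hm
    obtain ⟨m, hm0, hm1, _⟩ := hm
    apply hm0
    funext i
    have := hm1 i
    simpa using this
  show 1 ≤ sInf Sset
  omega

lemma Z_exist {d : ℕ} (hd : 2 ≤ d) (ξ : Fin d → ℝ) (η : ℝ)
    (hyp : η < (d : ℝ) ∨
      (η < (d : ℝ) + 1 ∧
        (d = 2 → Summable (fun l : ℕ =>
          (2:ℝ) ^ ((η - 2) * ((l : ℝ) + 1)) * ((zetaDio ξ ((2:ℝ) ^ l) : ℝ))⁻¹ ^ 2)) ∧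
        (3 ≤ d → Summable (fun l : ℕ =>
          ((l : ℝ) + 1) ^ ((d : ℝ) - 1) * (2:ℝ) ^ ((η - d) * ((l : ℝ) + 1)) *
            ((zetaDio ξ ((2:ℝ) ^ l) : ℝ))⁻¹)))) :
    ∃ (e : ℕ) (Z : ℕ → ℝ), (e = 1 ∨ (e = 2 ∧ d = 2)) ∧ (∀ l, 1 ≤ Z l) ∧
      (∀ l q, Sdio ξ l q → q ≠ 0 → Z l ≤ ‖iv q‖) ∧
      (∀ l q q', Sdio ξ l q → Sdio ξ l q' → q ≠ q' → Z l ≤ dist (iv q) (iv q')) ∧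
      Summable (fun l : ℕ => (2 : ℝ) ^ ((η - d) * (l : ℝ)) / Z l ^ e) := by
  rcases hyp with h | ⟨_, h2, h3⟩
  · refine ⟨1, fun _ => 1, Or.inl rfl, fun _ => le_rfl, ?_, ?_, ?_⟩
    · intro l q _ hq; exact iv_norm_ge_one q hq
    · intro l q q' _ _ hq; exact iv_dist_ge_one q q' hq
    · have : (fun l : ℕ => (2 : ℝ) ^ ((η - d) * (l : ℝ)) / 1 ^ 1) = fun l : ℕ => ((2 : ℝ) ^ (η - d)) ^ l := by
        funext l
        rw [Real.rpow_mul (by norm_num), Real.rpow_natCast]; simp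
      rw [this]
      apply summable_geometric_of_lt_one (by positivity)
      exact Real.rpow_lt_one_of_one_lt_of_neg (by norm_num) (by linarith)
  have hthr : ∀ l : ℕ, min ((2 : ℝ) ^ d / 2 ^ l) 1 ≤ 1 / 2 ^ (l - d) := by
    intro l
    by_cases hl : d ≤ l
    · refine (min_le_left _ _).trans (le_of_eq ?_)
      have : (2 : ℝ) ^ l = 2 ^ d * 2 ^ (l - d) := by rw [← pow_add]; congr 1; omega
      rw [this]; field_simp
    · refine (min_le_right _ _).trans (le_of_eq ?_)
      rw [Nat.sub_eq_zero_of_le (by omega)]; simp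
  have hhalf : ∀ x : ℝ, distToInt x ≤ 1 / 2 := fun x => abs_sub_round x
  have hpos : ∀ l : ℕ, (0 : ℝ) ≤ 2 ^ d / 2 ^ l := fun l => by positivity
  have key : ∀ e : ℕ, (e = 1 ∨ (e = 2 ∧ d = 2)) →
      Summable (fun l : ℕ => (2 : ℝ) ^ ((η - d) * ((l : ℝ) + 1)) / (zetaDio ξ ((2:ℝ) ^ l) : ℝ) ^ e) →
      ∃ (e : ℕ) (Z : ℕ → ℝ), (e = 1 ∨ (e = 2 ∧ d = 2)) ∧ (∀ l, 1 ≤ Z l) ∧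
      (∀ l q, Sdio ξ l q → q ≠ 0 → Z l ≤ ‖iv q‖) ∧
      (∀ l q q', Sdio ξ l q → Sdio ξ l q' → q ≠ q' → Z l ≤ dist (iv q) (iv q')) ∧
      Summable (fun l : ℕ => (2 : ℝ) ^ ((η - d) * (l : ℝ)) / Z l ^ e) := by
    intro e he hsum
    refine ⟨e, fun l => zetaDio ξ ((2 : ℝ) ^ (l - d)), he, ?_, ?_, ?_, ?_⟩
    · intro l; exact Nat.one_le_cast.2 (zeta_ge_one hd ξ (l - d))
    · intro l q hq hq0
      apply zeta_le _ _ _ hq0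
      refine le_trans (le_min ?_ ?_) (hthr l)
      · have h1 : distToInt (∑ i, ξ i * (q i : ℝ)) ≤ 2 ^ d / 2 ^ l / 2 := hq
        linarith [hpos l]
      · linarith [hhalf (∑ i, ξ i * (q i : ℝ))]
    · intro l q q' hq hq' hne
      rw [dist_eq_norm, ← iv_sub]
      apply zeta_le _ _ _ (sub_ne_zero.2 hne)
      have h0 : ∑ i, ξ i * ((q - q') i : ℝ) = ∑ i, ξ i * (q i : ℝ) - ∑ i, ξ i * (q' i : ℝ) := by
        rw [← Finset.sum_sub_distrib]
        refine Finset.sum_congr rfl fun i _ => ?_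
        simp only [Pi.sub_apply]; push_cast; ring
      rw [h0]
      refine le_trans (le_min ?_ ?_) (hthr l)
      · have h1 : distToInt (∑ i, ξ i * (q i : ℝ)) ≤ 2 ^ d / 2 ^ l / 2 := hq
        have h1' : distToInt (∑ i, ξ i * (q' i : ℝ)) ≤ 2 ^ d / 2 ^ l / 2 := hq'
        linarith [distToInt_sub (∑ i, ξ i * (q i : ℝ)) (∑ i, ξ i * (q' i : ℝ))]
      · linarith [hhalf (∑ i, ξ i * (q i : ℝ) - ∑ i, ξ i * (q' i : ℝ))]
    · rw [← summable_nat_add_iff d]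
      refine (hsum.mul_left ((2 : ℝ) ^ ((η - d) * ((d : ℝ) - 1)))).congr ?_
      intro l
      simp only [Nat.add_sub_cancel]
      rw [← mul_div_assoc, ← Real.rpow_add (by norm_num)]
      congr 2
      push_cast; ring
  by_cases hd2 : d = 2
  · refine key 2 (Or.inr ⟨rfl, hd2⟩) ((h2 hd2).congr ?_)
    intro l
    have hdr : (d : ℝ) = 2 := by exact_mod_cast hd2
    rw [hdr, inv_pow, ← div_eq_mul_inv]
  · refine key 1 (Or.inl rfl) (Summable.of_nonneg_of_le (fun l => by positivity) ?_ (h3 (by omega)))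
    intro l
    rw [pow_one, div_eq_mul_inv]
    gcongr
    have h1 : (1 : ℝ) ≤ ((l : ℝ) + 1) ^ ((d : ℝ) - 1) := by
      apply Real.one_le_rpow
      · have : (0 : ℝ) ≤ l := Nat.cast_nonneg l
        linarith
      · have : (2 : ℝ) ≤ d := by exact_mod_cast hd
        linarith
    have h4 : (0 : ℝ) ≤ (2 : ℝ) ^ ((η - d) * ((l : ℝ) + 1)) := by positivity
    nlinarith

lemma Ffun_nonneg {d : ℕ} (R η r : ℝ) (v b : Fin d → ℝ) (hv : ∀ i, 0 < v i) :
    0 ≤ Ffun d R η r v b := by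
  unfold Ffun
  apply mul_nonneg
  · split_ifs <;> norm_num
  · apply Finset.prod_nonneg
    intro i _
    have := (hv i).le
    split_ifs <;> positivity

def gw (η vm : ℝ) (l : ℕ) : ENNReal := ENNReal.ofReal ((vm * 2 ^ (l + 1)) ^ η)

def gW (η vm : ℝ) (L k : ℕ) (i l : ℕ) : ENNReal := if i = k ∧ l < L then 0 else gw η vm l

lemma tail_eq (g : ℕ → ENNReal) (L : ℕ) :
    ∑' l, (if l < L then 0 else g l) = ∑' l, g (l + L) := by
  have h := Summable.sum_add_tsum_nat_add' (f := fun l => if l < L then 0 else g l) (k := L)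
    ENNReal.summable
  rw [← h, Finset.sum_eq_zero, zero_add]
  · refine tsum_congr fun l => ?_
    rw [if_neg (by omega)]
  · intro i hi
    rw [if_pos (by simpa using hi)]

lemma gen_total {d : ℕ} (hd : 2 ≤ d) (ξ : Fin d → ℝ) (M0 : Matrix (Fin d) (Fin d) ℝ)
    (hM0 : M0.det = 1) (η vm A B : ℝ) (hvm : 0 < vm) (hA : 0 < A) (hB : 1 ≤ B)
    (e : ℕ) (Z : ℕ → ℝ) (he : e = 1 ∨ (e = 2 ∧ d = 2)) (hZ : ∀ l, 1 ≤ Z l)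
    (hS1 : ∀ l q, Sdio ξ l q → q ≠ 0 → Z l ≤ ‖iv q‖)
    (hS2 : ∀ l q q', Sdio ξ l q → Sdio ξ l q' → q ≠ q' → Z l ≤ dist (iv q) (iv q'))
    (hsum : Summable (fun l : ℕ => (2 : ℝ) ^ ((η - d) * (l : ℝ)) / Z l ^ e)) :
    ∃ T : ℕ → ENNReal, Tendsto T atTop (𝓝 0) ∧ ∀ (L : ℕ) (t : ℝ) (s k : ℕ), s ≤ d - 1 → k < s →
      Gen (okP (Sdio ξ) (XX d A t)) (gW η vm L k)
        (fun st => volume (zv M0 ⁻¹' EB (dd d A t) B st)) s [] ≤ T L := by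
  obtain ⟨C, hC, hgen⟩ := Gen_bound d hd
  set β : ℕ → ℝ := fun l => 1 / 2 ^ (d * l) / Z l ^ e with hβ
  set K : ℝ := 2 * A ^ d with hK
  have hK0 : 0 ≤ K := by positivity
  have hβ0 : ∀ l, 0 ≤ β l := fun l => by have := hZ l; simp only [hβ]; positivity
  set g : ℕ → ENNReal := fun l => gw η vm l * ENNReal.ofReal (β l) with hg
  have hgs : ∑' l, g l ≠ ⊤ := by
    have h1 : ∀ l, g l = ENNReal.ofReal ((vm * 2) ^ η * ((2 : ℝ) ^ ((η - d) * (l : ℝ)) / Z l ^ e)) := by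
      intro l
      simp only [hg, gw]
      rw [← ENNReal.ofReal_mul (by positivity)]
      congr 1
      simp only [hβ]
      have h2 : (vm * 2 ^ (l + 1)) ^ η = (vm * 2) ^ η * (2 : ℝ) ^ (η * l) := by
        rw [show vm * 2 ^ (l + 1) = (vm * 2) * 2 ^ l by ring, Real.mul_rpow (by positivity) (by positivity),
          ← Real.rpow_natCast, ← Real.rpow_mul (by norm_num), mul_comm (l : ℝ)]
      have h3 : (2 : ℝ) ^ ((η - d) * (l : ℝ)) = (2 : ℝ) ^ (η * l) / 2 ^ (d * l) := by
        rw [sub_mul, Real.rpow_sub (by norm_num)]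
        congr 1
        rw [← Real.rpow_natCast]
        push_cast; rfl
      rw [h2, h3]
      ring
    simp_rw [h1]
    exact (hsum.mul_left _).tsum_ofReal_ne_top
  set σ := ∑' l, g l with hσ
  set c := ENNReal.ofReal (C * K) with hc
  set V := volume (Metric.closedBall (0 : EE d) (2 ^ d * (2 * B))) with hV
  have hVt : V ≠ ⊤ := measure_closedBall_lt_top.ne
  refine ⟨fun L => (c * (1 + c * σ) ^ d * V) * ∑' l, g (l + L), ?_, ?_⟩
  · have h1 := ENNReal.tendsto_sum_nat_add g hgs
    have h2 := ENNReal.Tendsto.const_mul (a := c * (1 + c * σ) ^ d * V) h1 (Or.inr (by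
      have : c ≠ ⊤ := ENNReal.ofReal_ne_top
      have h3 : c * σ ≠ ⊤ := ENNReal.mul_ne_top this hgs
      apply ENNReal.mul_ne_top _ hVt
      apply ENNReal.mul_ne_top this
      apply ENNReal.pow_ne_top
      exact ENNReal.add_ne_top.2 ⟨ENNReal.one_ne_top, h3⟩))
    rw [mul_zero] at h2
    exact h2
  · intro L t s k hs hk
    refine (Gen_mono _ _ _ _ (fun st => Y_vol hd M0 hM0 (dd d A t) B st) s []).trans ?_
    have h1 := hgen e he (Sdio ξ) (XX d A t) Z (fun l => 2 * dd d A t l) β K (2 * B) (gW η vm L k)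
      (by linarith) hK0 (fun l => by unfold XX; positivity) hZ (fun l => by unfold dd; positivity)
      hS1 hS2 (by
        intro l
        have h2 : 2 * dd d A t l * XX d A t l ^ (d - 1) = K * (1 / 2 ^ (d * l)) := by
          obtain ⟨n, rfl⟩ : ∃ n, d = n + 1 := ⟨d - 1, by omega⟩
          simp only [Nat.add_sub_cancel]
          unfold dd XX
          have h3 : Real.exp (-(((n + 1 : ℕ) : ℝ) - 1) * t / (n + 1 : ℕ)) *
              Real.exp (t / (n + 1 : ℕ)) ^ n = 1 := by
            rw [← Real.exp_nat_mul, ← Real.exp_add, Real.exp_eq_one_iff]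
            push_cast
            ring
          rw [hK, div_pow, mul_pow]
          calc _ = 2 * (A ^ n * A) * (Real.exp (-(((n + 1 : ℕ) : ℝ) - 1) * t / (n + 1 : ℕ)) *
              Real.exp (t / (n + 1 : ℕ)) ^ n) * (1 / (2 ^ l * (2 ^ l) ^ n)) := by
                field_simp
            _ = _ := by
                rw [h3, ← pow_succ, ← pow_succ', ← pow_mul, mul_one, mul_comm l]
        rw [h2]
        simp only [hβ]
        rw [mul_div_assoc]) s [] (by simpa using hs)
    refine h1.trans ?_
    have hVle : volume (EB (fun l => 2 * dd d A t l) (2 ^ s * (2 * B)) ([] : List (ℕ × (Fin d → ℤ)))) ≤ V := by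
      apply measure_mono
      intro z hz
      rw [mem_closedBall_zero_iff]
      refine hz.1.trans ?_
      have : s ≤ d := by omega
      gcongr
      norm_num
    have hprod : ∏ i ∈ Finset.range s, (c * ∑' l, gW η vm L k (([] : List (ℕ × (Fin d → ℤ))).length + i) l *
        ENNReal.ofReal (β l)) ≤ (c * ∑' l, g (l + L)) * (1 + c * σ) ^ d := by
      simp only [List.length_nil, zero_add]
      rw [← Finset.mul_prod_erase _ _ (Finset.mem_range.2 hk)]
      gcongr ?_ * ?_
      · gcongr c * ?_
        rw [← tail_eq]
        refine le_of_eq (tsum_congr fun l => ?_)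
        simp only [gW, hg, true_and]
        split_ifs <;> simp
      · calc _ ≤ ∏ i ∈ (Finset.range s).erase k, (1 + c * σ) := by
              apply Finset.prod_le_prod'
              intro i _
              refine le_trans ?_ le_add_self
              gcongr c * ?_
              refine ENNReal.tsum_le_tsum fun l => ?_
              simp only [hg, gW]
              split_ifs <;> simp
          _ = (1 + c * σ) ^ ((Finset.range s).erase k).card := by rw [Finset.prod_const]
          _ ≤ _ := by
              apply pow_le_pow_right₀ le_self_add
              refine (Finset.card_le_card (Finset.erase_subset _ _)).trans ?_
              rw [Finset.card_range]; omega
    calc _ ≤ ((c * ∑' l, g (l + L)) * (1 + c * σ) ^ d) * V := mul_le_mul' hprod hVle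
      _ = _ := by ring

lemma main_bound {d : ℕ} (hd : 2 ≤ d) (ξ : Fin d → ℝ)
    (M0 : Matrix (Fin d) (Fin d) ℝ) (hM0 : M0.det = 1)
    (η r : ℝ) (hη : 0 < η) (hr : 0 < r)
    (ψ : (Fin (d - 1) → ℝ) → ℝ) (hψc : Continuous ψ) (hψs : HasCompactSupport ψ)
    (vc bc : (Matrix (Fin d) (Fin d) ℝ × (Fin d → ℝ)) → (Fin d → ℝ))
    (hsec : IsSiegelSection d vc bc)
    (hyp : η < (d : ℝ) ∨
      (η < (d : ℝ) + 1 ∧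
        (d = 2 → Summable (fun l : ℕ =>
          (2:ℝ) ^ ((η - 2) * ((l : ℝ) + 1)) * ((zetaDio ξ ((2:ℝ) ^ l) : ℝ))⁻¹ ^ 2)) ∧
        (3 ≤ d → Summable (fun l : ℕ =>
          ((l : ℝ) + 1) ^ ((d : ℝ) - 1) * (2:ℝ) ^ ((η - d) * ((l : ℝ) + 1)) *
            ((zetaDio ξ ((2:ℝ) ^ l) : ℝ))⁻¹)))) (ε : ℝ) (hε : 0 < ε) :
    ∃ R0 : ℝ, ∀ R, R0 ≤ R → ∀ t : ℝ, 0 ≤ t →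
      |∫ y : Fin (d - 1) → ℝ,
          Ffun d R η r (vc (gElt d ξ M0 y t)) (bc (gElt d ξ M0 y t)) * ψ y| ≤ ε := by
  have hd0 : (0 : ℝ) < d := by exact_mod_cast (by omega : 0 < d)
  obtain ⟨e, Z, he, hZ, hS1, hS2, hsum⟩ := Z_exist hd ξ η hyp
  obtain ⟨Ψ, hΨ⟩ := hψs.exists_bound_of_continuous hψc
  have hcomp : IsCompact (tsupport ψ) := hψs
  obtain ⟨Y1, hY1⟩ := hcomp.exists_bound_of_continuousOn (f := fun y => y) continuousOn_id
  obtain ⟨B1, hB1⟩ := hcomp.exists_bound_of_continuousOn (f := zv M0) (zv_cont M0).continuousOn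
  set Y0 := max Y1 0 with hY0
  set B := max B1 1 with hB
  obtain ⟨A, hA, hpt⟩ := pointwise hd ξ M0 hM0 η r hη hr vc bc hsec Y0 B (le_max_right _ _)
  set vm := 2 * (d : ℝ) * r with hvm
  have hvm0 : 0 < vm := by positivity
  obtain ⟨T, hT, hTb⟩ := gen_total hd ξ M0 hM0 η vm A B hvm0 hA (le_max_right _ _) e Z he hZ hS1 hS2 hsum
  have hlim : Tendsto (fun L => ENNReal.ofReal Ψ * (((d * d : ℕ) : ENNReal) * T L)) atTop (𝓝 0) := by
    have h1 := ENNReal.Tendsto.const_mul (a := ((d * d : ℕ) : ENNReal)) hT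
      (Or.inr (ENNReal.natCast_ne_top _))
    rw [mul_zero] at h1
    have h2 := ENNReal.Tendsto.const_mul (a := ENNReal.ofReal Ψ) h1 (Or.inr ENNReal.ofReal_ne_top)
    rw [mul_zero] at h2
    exact h2
  obtain ⟨L, hL⟩ := ((tendsto_order.1 hlim).2 (ENNReal.ofReal ε) (ENNReal.ofReal_pos.2 hε)).exists
  refine ⟨(max 1 (vm * 2 ^ L)) ^ d + 1, ?_⟩
  intro R hR t ht
  let G : ℕ → ℕ → (Fin (d - 1) → ℝ) → ENNReal := fun s k y =>
    Gen (okP (Sdio ξ) (XX d A t)) (gW η vm L k)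
      (fun st => (zv M0 ⁻¹' EB (dd d A t) B st).indicator (fun _ => (1 : ENNReal)) y) s []
  have hYm : ∀ st, MeasurableSet (zv M0 ⁻¹' EB (dd d A t) B st) := fun st =>
    (EB_closed _ _ _).measurableSet.preimage (zv_cont M0).measurable
  have hφ : ∀ st, Measurable (fun y => (zv M0 ⁻¹' EB (dd d A t) B st).indicator (fun _ => (1 : ENNReal)) y) :=
    fun st => measurable_const.indicator (hYm st)
  have hGm : ∀ s k, Measurable (G s k) := fun s k =>
    Gen_meas _ _ (fun st y => (zv M0 ⁻¹' EB (dd d A t) B st).indicator (fun _ => (1 : ENNReal)) y) hφ s []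
  have hGi : ∀ s k, s ≤ d - 1 → k < s → ∫⁻ y, G s k y ≤ T L := by
    intro s k hs hk
    simp only [G]
    rw [Gen_lintegral volume _ _
      (fun st y => (zv M0 ⁻¹' EB (dd d A t) B st).indicator (fun _ => (1 : ENNReal)) y) hφ s []]
    refine le_trans (le_of_eq ?_) (hTb L t s k hs hk)
    congr 1
    funext st
    rw [lintegral_indicator (hYm st), setLIntegral_const, one_mul]
  have hpw : ∀ y, ‖Ffun d R η r (vc (gElt d ξ M0 y t)) (bc (gElt d ξ M0 y t)) * ψ y‖ₑ ≤
      ENNReal.ofReal Ψ * ∑ s ∈ Finset.range d, ∑ k ∈ Finset.range s, G s k y := by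
    intro y
    by_cases hψ0 : ψ y = 0
    · rw [hψ0, mul_zero]; simp
    by_cases hF0 : Ffun d R η r (vc (gElt d ξ M0 y t)) (bc (gElt d ξ M0 y t)) = 0
    · rw [hF0, zero_mul]; simp
    have hys : y ∈ tsupport ψ := subset_tsupport _ hψ0
    have hy : ∀ j, |y j| ≤ Y0 := by
      intro j
      have h1 := hY1 y hys
      have h2 := norm_le_pi_norm y j
      rw [Real.norm_eq_abs] at h2
      exact h2.trans (h1.trans (le_max_left _ _))
    have hz : ‖zv M0 y‖ ≤ B := (hB1 y hys).trans (le_max_left _ _)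
    obtain ⟨s, p, hs, hok, hEB, hFle, k, hk, hLk⟩ := hpt y t hy ht hz L R (by linarith) hF0
    have hFn : 0 ≤ Ffun d R η r (vc (gElt d ξ M0 y t)) (bc (gElt d ξ M0 y t)) :=
      Ffun_nonneg R η r _ _ (hsec.2.2 (gElt d ξ M0 y t) (det_gM hd M0 hM0 y t)).1.1
    rw [enorm_mul, mul_comm]
    have h1 : ‖ψ y‖ₑ ≤ ENNReal.ofReal Ψ := by
      rw [← ofReal_norm]
      exact ENNReal.ofReal_le_ofReal (hΨ y)
    have h2 : ‖Ffun d R η r (vc (gElt d ξ M0 y t)) (bc (gElt d ξ M0 y t))‖ₑ ≤ G s k y := by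
      rw [Real.enorm_of_nonneg hFn]
      refine (ENNReal.ofReal_le_ofReal hFle).trans ?_
      rw [ENNReal.ofReal_prod_of_nonneg (fun i _ => by positivity)]
      have h3 := Gen_path (okP (Sdio ξ) (XX d A t)) (gW η vm L k)
        (fun st => (zv M0 ⁻¹' EB (dd d A t) B st).indicator (fun _ => (1 : ENNReal)) y) p s 0
        (fun i hi => hok i (by omega))
      refine le_trans (le_of_eq ?_) h3
      simp only [zero_add]
      rw [Set.indicator_of_mem (show y ∈ zv M0 ⁻¹' EB (dd d A t) B (stk p s) from hEB), mul_one]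
      refine Finset.prod_congr rfl fun i _ => ?_
      unfold gW gw
      rw [if_neg]
      rintro ⟨rfl, h5⟩
      omega
    have h4 : G s k y ≤ ∑ s ∈ Finset.range d, ∑ k ∈ Finset.range s, G s k y := by
      have h5 : G s k y ≤ ∑ k ∈ Finset.range s, G s k y :=
        Finset.single_le_sum (f := fun k => G s k y) (fun _ _ => zero_le) (Finset.mem_range.2 hk)
      have h6 : ∑ k ∈ Finset.range s, G s k y ≤ ∑ s ∈ Finset.range d, ∑ k ∈ Finset.range s, G s k y :=
        Finset.single_le_sum (f := fun s => ∑ k ∈ Finset.range s, G s k y) (fun _ _ => zero_le)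
          (Finset.mem_range.2 (by omega))
      exact h5.trans h6
    exact mul_le_mul' h1 (h2.trans h4)
  have hfin : ‖∫ y : Fin (d - 1) → ℝ,
      Ffun d R η r (vc (gElt d ξ M0 y t)) (bc (gElt d ξ M0 y t)) * ψ y‖ₑ ≤ ENNReal.ofReal ε := by
    refine (enorm_integral_le_lintegral_enorm _).trans ?_
    refine (lintegral_mono hpw).trans ?_
    rw [lintegral_const_mul _ (Finset.measurable_sum _ fun s _ => Finset.measurable_sum _ fun k _ => hGm s k),
      lintegral_finsetSum _ (fun s _ => Finset.measurable_sum _ fun k _ => hGm s k)]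
    refine le_trans ?_ hL.le
    gcongr
    calc ∑ s ∈ Finset.range d, ∫⁻ y, ∑ k ∈ Finset.range s, G s k y
        ≤ ∑ s ∈ Finset.range d, (d : ENNReal) * T L := by
          refine Finset.sum_le_sum fun s hs => ?_
          rw [lintegral_finsetSum _ (fun k _ => hGm s k)]
          have hsd : s < d := Finset.mem_range.1 hs
          calc ∑ k ∈ Finset.range s, ∫⁻ y, G s k y ≤ ∑ k ∈ Finset.range s, T L :=
                Finset.sum_le_sum fun k hk => hGi s k (by omega) (Finset.mem_range.1 hk)
            _ = (s : ENNReal) * T L := by simp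
            _ ≤ _ := by gcongr
      _ = _ := by
        rw [Finset.sum_const, Finset.card_range, nsmul_eq_mul]
        push_cast; ring
  rw [← ofReal_norm, ENNReal.ofReal_le_ofReal_iff hε.le] at hfin
  exact hfin

/-- Proposition: no escape of mass for horospherical averages:
lim_{R→∞} limsup_{t→∞} |∫ F_{R,η,r}(Γ'(1,ξ)(M₀ñ(y)Φ_t,0)) ψ(y) dy| = 0 under
(B1) or (B2), for any Siegel section (vc, bc). -/
theorem stmt12 (d : ℕ) (hd : 2 ≤ d) (ξ : Fin d → ℝ)
    (M0 : Matrix (Fin d) (Fin d) ℝ) (hM0 : M0.det = 1)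
    (η r : ℝ) (hη : 0 < η) (hr : 0 < r)
    (ψ : (Fin (d - 1) → ℝ) → ℝ) (hψc : Continuous ψ) (hψs : HasCompactSupport ψ)
    (vc bc : (Matrix (Fin d) (Fin d) ℝ × (Fin d → ℝ)) → (Fin d → ℝ))
    (hsec : IsSiegelSection d vc bc)
    (hyp : η < (d : ℝ) ∨
      (η < (d : ℝ) + 1 ∧
        (d = 2 → Summable (fun l : ℕ =>
          (2:ℝ) ^ ((η - 2) * ((l : ℝ) + 1)) * ((zetaDio ξ ((2:ℝ) ^ l) : ℝ))⁻¹ ^ 2)) ∧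
        (3 ≤ d → Summable (fun l : ℕ =>
          ((l : ℝ) + 1) ^ ((d : ℝ) - 1) * (2:ℝ) ^ ((η - d) * ((l : ℝ) + 1)) *
            ((zetaDio ξ ((2:ℝ) ^ l) : ℝ))⁻¹)))) :
    Tendsto (fun R : ℝ =>
      limsup (fun t : ℝ =>
        |∫ y : Fin (d - 1) → ℝ,
          Ffun d R η r (vc (gElt d ξ M0 y t)) (bc (gElt d ξ M0 y t)) * ψ y|) atTop)
      atTop (𝓝 0) := by
  rw [Metric.tendsto_atTop]
  intro ε hε
  obtain ⟨R0, hR0⟩ := main_bound hd ξ M0 hM0 η r hη hr ψ hψc hψs vc bc hsec hyp (ε / 2) (by linarith)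
  refine ⟨R0, fun R hR => ?_⟩
  have hev : ∀ᶠ t : ℝ in atTop, |∫ y : Fin (d - 1) → ℝ,
      Ffun d R η r (vc (gElt d ξ M0 y t)) (bc (gElt d ξ M0 y t)) * ψ y| ≤ ε / 2 :=
    (eventually_ge_atTop 0).mono fun t ht => hR0 R hR t ht
  have hbdd : IsBoundedUnder (· ≤ ·) atTop (fun t : ℝ => |∫ y : Fin (d - 1) → ℝ,
      Ffun d R η r (vc (gElt d ξ M0 y t)) (bc (gElt d ξ M0 y t)) * ψ y|) := ⟨ε / 2, hev⟩
  have hcob : IsCoboundedUnder (· ≤ ·) atTop (fun t : ℝ => |∫ y : Fin (d - 1) → ℝ,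
      Ffun d R η r (vc (gElt d ξ M0 y t)) (bc (gElt d ξ M0 y t)) * ψ y|) :=
    (isBoundedUnder_of ⟨0, fun t => abs_nonneg _⟩ :
      IsBoundedUnder (· ≥ ·) atTop _).isCoboundedUnder_le
  have h1 := limsup_le_of_le hcob hev
  have h2 := le_limsup_of_frequently_le (a := (0 : ℝ))
    (Eventually.frequently (Eventually.of_forall fun t => abs_nonneg _)) hbdd
  rw [Real.dist_eq, sub_zero, abs_of_nonneg h2]
  linarith

end
end
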